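/- Let κ be a perfect kernel on X satisfying Frostman's maximum principle and the domination principle, let A ⊆ X satisfy cap_*(A) > 0 and E⁺(A) closed in (E⁺, d), and let f := −U^ζ where ζ ∈ E⁺ and ζ(X) ≤ 1. Then the solution λ_{A,f} of the inner Gauss variational problem for (A, f) exists if and only if either cap_*(A) < ∞ or ζ^A(X) = 1. In the affirmative case: if cap_*(A) < ∞ then λ_{A,f} = ζ^A + η_{A,f}·γ_A, where η_{A,f} := (1 − ζ^A(X))/cap_*(A) and γ_A is the inner capacitary measure of A; if cap_*(A) = ∞ then λ_{A,f} = ζ^A. -/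

import Mathlib

open MeasureTheory Topology Filter Set ENNReal

noncomputable section

namespace GaussVar

variable {X : Type*} [TopologicalSpace X] [MeasurableSpace X]

/-- A (positive) Radon measure: a regular Borel measure. -/
def IsRadon (μ : Measure X) : Prop := μ.Regular

/-- The mutual energy `I(μ,ν) = ∬ κ(x,y) d(μ⊗ν)(x,y)`. -/
def mutualEnergy (κ : X → X → ℝ≥0∞) (μ ν : Measure X) : ℝ≥0∞ :=
  ∫⁻ p : X × X, κ p.1 p.2 ∂(μ.prod ν)

/-- The energy `I(μ) := I(μ,μ)`. -/
def energy (κ : X → X → ℝ≥0∞) (μ : Measure X) : ℝ≥0∞ := mutualEnergy κ μ μ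

/-- Membership in the cone `E⁺` of Radon measures with finite energy. -/
def memEplus (κ : X → X → ℝ≥0∞) (μ : Measure X) : Prop :=
  IsRadon μ ∧ energy κ μ < ⊤

/-- A kernel: symmetric and lower semicontinuous with values in `[0,∞]`. -/
def IsKernel (κ : X → X → ℝ≥0∞) : Prop :=
  (∀ x y, κ x y = κ y x) ∧ LowerSemicontinuous (fun p : X × X => κ p.1 p.2)

/-- The strong (energy) metric `d(μ,ν) := (I(μ)+I(ν)−2I(μ,ν))^{1/2}` on `E⁺`. -/
def strongDist (κ : X → X → ℝ≥0∞) (μ ν : Measure X) : ℝ :=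
  Real.sqrt ((energy κ μ).toReal + (energy κ ν).toReal - 2 * (mutualEnergy κ μ ν).toReal)

/-- The energy principle (strict positive definiteness). -/
def EnergyPrinciple (κ : X → X → ℝ≥0∞) : Prop :=
  ∀ μ ν : Measure X, memEplus κ μ → memEplus κ ν →
    2 * mutualEnergy κ μ ν ≤ energy κ μ + energy κ ν ∧
      (2 * mutualEnergy κ μ ν = energy κ μ + energy κ ν → μ = ν)

/-- Convergence of a sequence in the strong metric. -/
def StrongTendstoSeq (κ : X → X → ℝ≥0∞) (μ : ℕ → Measure X) (μ₀ : Measure X) : Prop :=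
  Tendsto (fun n => strongDist κ (μ n) μ₀) atTop (𝓝 0)

/-- Vague convergence of a sequence of measures. -/
def VagueTendstoSeq (μ : ℕ → Measure X) (μ₀ : Measure X) : Prop :=
  ∀ φ : X → ℝ, Continuous φ → HasCompactSupport φ →
    Tendsto (fun n => ∫ x, φ x ∂(μ n)) atTop (𝓝 (∫ x, φ x ∂μ₀))

/-- Cauchy sequence in the strong metric. -/
def StrongCauchySeq (κ : X → X → ℝ≥0∞) (μ : ℕ → Measure X) : Prop :=
  ∀ ε : ℝ, 0 < ε → ∃ N : ℕ, ∀ m ≥ N, ∀ n ≥ N, strongDist κ (μ m) (μ n) < ε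

/-- A perfect kernel: satisfies the energy principle, `(E⁺,d)` is complete, and
strong convergence implies vague convergence. -/
def IsPerfect (κ : X → X → ℝ≥0∞) : Prop :=
  EnergyPrinciple κ ∧
    (∀ μ : ℕ → Measure X, (∀ n, memEplus κ (μ n)) → StrongCauchySeq κ μ →
        ∃ μ₀ : Measure X, memEplus κ μ₀ ∧ StrongTendstoSeq κ μ μ₀) ∧
    (∀ (μ : ℕ → Measure X) (μ₀ : Measure X), (∀ n, memEplus κ (μ n)) → memEplus κ μ₀ →
        StrongTendstoSeq κ μ μ₀ → VagueTendstoSeq μ μ₀)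

/-- `μ` is concentrated on `A`: the complement of `A` is locally `μ`-negligible. -/
def Concentrated (μ : Measure X) (A : Set X) : Prop :=
  ∀ K : Set X, IsCompact K → μ (Aᶜ ∩ K) = 0

/-- Membership in `Ĕ⁺(A)`: finite-energy Radon measures concentrated on `A`
of unit total mass. -/
def memBreve (κ : X → X → ℝ≥0∞) (A : Set X) (μ : Measure X) : Prop :=
  memEplus κ μ ∧ Concentrated μ A ∧ μ Set.univ = 1

/-- `w(A) := inf { I(μ) : μ ∈ Ĕ⁺(A) }` (with `inf ∅ = ⊤`). -/
def wcap (κ : X → X → ℝ≥0∞) (A : Set X) : ℝ≥0∞ :=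
  ⨅ (μ : Measure X) (_ : memBreve κ A μ), energy κ μ

/-- The inner capacity `cap_*(A) := 1 / w(A)`. -/
def innerCap (κ : X → X → ℝ≥0∞) (A : Set X) : ℝ≥0∞ := (wcap κ A)⁻¹

/-- The outer capacity `cap^*(E) := inf { cap_*(D) : D open, E ⊆ D }`. -/
def outerCap (κ : X → X → ℝ≥0∞) (E : Set X) : ℝ≥0∞ :=
  ⨅ (D : Set X) (_ : IsOpen D ∧ E ⊆ D), innerCap κ D

/-- `P` holds nearly everywhere (n.e.) on `A`: the exceptional subset of `A`
has inner capacity zero. -/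
def NearlyEverywhere (κ : X → X → ℝ≥0∞) (A : Set X) (P : X → Prop) : Prop :=
  innerCap κ {x ∈ A | ¬ P x} = 0

/-- The potential `U^μ(x) := ∫ κ(x,y) dμ(y)`. -/
def potential (κ : X → X → ℝ≥0∞) (μ : Measure X) (x : X) : ℝ≥0∞ :=
  ∫⁻ y, κ x y ∂μ

/-- An external field: `f = ψ + U^{ϑ⁺} − U^{ϑ⁻}` where `ψ` is lower semicontinuous,
`(−∞,∞]`-valued, positive if `X` is noncompact, and `ϑ⁺, ϑ⁻ ∈ E⁺`. -/
def IsExternalField (κ : X → X → ℝ≥0∞) (f : X → EReal) : Prop :=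
  ∃ (ψ : X → EReal) (ϑp ϑm : Measure X),
    LowerSemicontinuous ψ ∧ (∀ x, ψ x ≠ ⊥) ∧ (¬ CompactSpace X → ∀ x, 0 ≤ ψ x) ∧
    memEplus κ ϑp ∧ memEplus κ ϑm ∧
    ∀ x, f x = ψ x + (potential κ ϑp x : EReal) - (potential κ ϑm x : EReal)

/-- `f` is `μ`-integrable (as an extended-real-valued function). -/
def FieldIntegrable (f : X → EReal) (μ : Measure X) : Prop :=
  Integrable (fun x => (f x).toReal) μ ∧ (∀ᵐ x ∂μ, f x ≠ ⊤ ∧ f x ≠ ⊥)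

/-- `∫ f dμ` for an a.e.-finite integrable field. -/
def fieldIntegral (f : X → EReal) (μ : Measure X) : ℝ := ∫ x, (f x).toReal ∂μ

/-- The Gauss functional `I_f(μ) := I(μ) + 2 ∫ f dμ`. -/
def gaussI (κ : X → X → ℝ≥0∞) (f : X → EReal) (μ : Measure X) : ℝ :=
  (energy κ μ).toReal + 2 * fieldIntegral f μ

/-- Membership in `Ĕ⁺_f(A)`. -/
def Admissible (κ : X → X → ℝ≥0∞) (A : Set X) (f : X → EReal) (μ : Measure X) : Prop :=
  memBreve κ A μ ∧ FieldIntegrable f μ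

/-- `w_f(A) := inf { I_f(μ) : μ ∈ Ĕ⁺_f(A) }` (with `inf ∅ = ⊤`). -/
def wf (κ : X → X → ℝ≥0∞) (A : Set X) (f : X → EReal) : EReal :=
  ⨅ (μ : Measure X) (_ : Admissible κ A f μ), ((gaussI κ f μ : ℝ) : EReal)

/-- `l` is a solution of the inner Gauss variational problem for `(A,f)`. -/
def IsSolution (κ : X → X → ℝ≥0∞) (A : Set X) (f : X → EReal) (l : Measure X) : Prop :=
  Admissible κ A f l ∧ ((gaussI κ f l : ℝ) : EReal) = wf κ A f

/-- The `f`-weighted potential `U_f^μ := U^μ + f`. -/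
def wPotential (κ : X → X → ℝ≥0∞) (f : X → EReal) (μ : Measure X) (x : X) : EReal :=
  (potential κ μ x : EReal) + f x

/-- `∫ U_f^μ dμ`, the weighted equilibrium constant of a solution. -/
def wConst (κ : X → X → ℝ≥0∞) (f : X → EReal) (μ : Measure X) : ℝ :=
  ∫ x, (wPotential κ f μ x).toReal ∂μ

/-- The cone `E⁺(A)` is closed in the strong metric. -/
def StrongClosedEplusOn (κ : X → X → ℝ≥0∞) (A : Set X) : Prop :=
  ∀ (μ : ℕ → Measure X) (μ₀ : Measure X),
    (∀ n, memEplus κ (μ n) ∧ Concentrated (μ n) A) →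
    memEplus κ μ₀ → StrongTendstoSeq κ μ μ₀ → Concentrated μ₀ A

/-- Frostman's (first) maximum principle. -/
def FrostmanMax (κ : X → X → ℝ≥0∞) : Prop :=
  ∀ μ : Measure X, memEplus κ μ →
    (∀ x : X, (∀ U : Set X, IsOpen U → x ∈ U → 0 < μ U) → potential κ μ x ≤ 1) →
    ∀ x : X, potential κ μ x ≤ 1

/-- The domination (second maximum) principle. -/
def DominationPrinciple (κ : X → X → ℝ≥0∞) : Prop :=
  ∀ μ ν : Measure X, memEplus κ μ → memEplus κ ν →
    (∀ᵐ x ∂μ, potential κ μ x ≤ potential κ ν x) →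
    ∀ x : X, potential κ μ x ≤ potential κ ν x

/-- `β` is the inner balayage of `ζ` onto `A`: `β ∈ E⁺(A)` and `U^β = U^ζ` n.e. on `A`. -/
def IsInnerBalayage (κ : X → X → ℝ≥0∞) (A : Set X) (ζ β : Measure X) : Prop :=
  memEplus κ β ∧ Concentrated β A ∧
    NearlyEverywhere κ A (fun x => potential κ β x = potential κ ζ x)

/-- `γ` is the inner capacitary measure of `A`: `γ ∈ E⁺(A)` and `U^γ = 1` n.e. on `A`. -/
def IsCapacitaryMeasure (κ : X → X → ℝ≥0∞) (A : Set X) (γ : Measure X) : Prop :=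
  memEplus κ γ ∧ Concentrated γ A ∧
    NearlyEverywhere κ A (fun x => potential κ γ x = 1)

/-- `A` is quasiclosed: approximable in outer capacity by closed sets. -/
def Quasiclosed (κ : X → X → ℝ≥0∞) (A : Set X) : Prop :=
  ∀ ε : ℝ≥0∞, 0 < ε → ∃ F : Set X, IsClosed F ∧ outerCap κ (symmDiff A F) < ε

/-- `A` is quasicompact: approximable in outer capacity by compact sets. -/
def Quasicompact (κ : X → X → ℝ≥0∞) (A : Set X) : Prop :=
  ∀ ε : ℝ≥0∞, 0 < ε → ∃ K : Set X, IsCompact K ∧ outerCap κ (symmDiff A K) < ε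


set_option linter.unusedSectionVars false

/-- The lower staircase approximation of `t` with `n` steps of height `ε`. -/
def staircase (ε : ℝ≥0∞) (n : ℕ) (t : ℝ≥0∞) : ℝ≥0∞ :=
  ∑ k ∈ Finset.range n, if ((k : ℝ≥0∞) + 1) * ε < t then ε else 0

lemma staircase_le_mul (ε : ℝ≥0∞) (n : ℕ) (t : ℝ≥0∞) : staircase ε n t ≤ n * ε := by
  calc staircase ε n t ≤ ∑ _k ∈ Finset.range n, ε :=
        Finset.sum_le_sum fun k _ => by split_ifs <;> simp
    _ = n * ε := by simp

lemma staircase_le (ε : ℝ≥0∞) (n : ℕ) (t : ℝ≥0∞) : staircase ε n t ≤ t := by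
  induction n with
  | zero => simp [staircase]
  | succ n ih =>
    rw [staircase, Finset.sum_range_succ]
    split_ifs with h
    · refine le_trans ?_ h.le
      rw [add_mul, one_mul]
      exact add_le_add_left (staircase_le_mul ε n t) ε
    · simpa [staircase] using ih

lemma staircase_eq_of_lt {ε : ℝ≥0∞} {n : ℕ} {t : ℝ≥0∞} (h : (n : ℝ≥0∞) * ε < t) :
    staircase ε n t = n * ε := by
  have : ∀ k ∈ Finset.range n, (if ((k : ℝ≥0∞) + 1) * ε < t then ε else 0) = ε := by
    intro k hk
    rw [if_pos]
    refine lt_of_le_of_lt ?_ h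
    gcongr
    exact_mod_cast Finset.mem_range.1 hk
  rw [staircase, Finset.sum_congr rfl this]
  simp

lemma min_le_staircase_add (ε : ℝ≥0∞) (n : ℕ) (t : ℝ≥0∞) :
    min t (n * ε) ≤ staircase ε n t + ε := by
  induction n with
  | zero => simp
  | succ n ih =>
    rcases lt_or_ge (((n + 1 : ℕ) : ℝ≥0∞) * ε) t with h | h
    · rw [staircase_eq_of_lt h]
      exact (min_le_right _ _).trans le_self_add
    · rw [min_eq_left h]
      have hs : staircase ε (n + 1) t = staircase ε n t := by
        rw [staircase, Finset.sum_range_succ, if_neg (by push_cast at h; exact not_lt.2 h), add_zero]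
        rfl
      rw [hs]
      rcases lt_or_ge ((n : ℝ≥0∞) * ε) t with h' | h'
      · rw [staircase_eq_of_lt h']
        simpa [add_mul] using h
      · rwa [min_eq_left h'] at ih

lemma lintegral_staircase [BorelSpace X] {g : X → ℝ≥0∞} (hg : LowerSemicontinuous g)
    (μ : Measure X) (ε : ℝ≥0∞) (n : ℕ) :
    ∫⁻ x, staircase ε n (g x) ∂μ =
      ∑ k ∈ Finset.range n, ε * μ {x | ((k : ℝ≥0∞) + 1) * ε < g x} := by
  have hm : ∀ k : ℕ, MeasurableSet {x | ((k : ℝ≥0∞) + 1) * ε < g x} := fun k =>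
    (hg.isOpen_preimage _).measurableSet
  have hi : ∀ k : ℕ, (fun x => if ((k : ℝ≥0∞) + 1) * ε < g x then ε else 0) =
      {x | ((k : ℝ≥0∞) + 1) * ε < g x}.indicator fun _ => ε := fun k => by
    ext x; simp [Set.indicator]
  simp only [staircase]
  rw [lintegral_finsetSum']
  · refine Finset.sum_congr rfl fun k _ => ?_
    rw [hi, lintegral_indicator_const (hm k)]
  · intro k _
    rw [hi]
    exact (measurable_const.indicator (hm k)).aemeasurable

/-- A regular measure is `τ`-additive on directed unions of open sets. -/
lemma measure_iUnion_of_directed_isOpen [BorelSpace X] {ι : Type*} [Nonempty ι]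
    (μ : Measure X) [μ.Regular] {U : ι → Set X} (hU : ∀ i, IsOpen (U i))
    (hd : Directed (· ⊆ ·) U) : μ (⋃ i, U i) = ⨆ i, μ (U i) := by
  refine le_antisymm ?_ (iSup_le fun i => measure_mono (subset_iUnion U i))
  rw [(isOpen_iUnion hU).measure_eq_iSup_isCompact]
  refine iSup₂_le fun K hK => iSup_le fun hKc => ?_
  obtain ⟨i, hi⟩ := hKc.elim_directed_cover U hU hK hd
  exact le_iSup_of_le i (measure_mono hi)

/-- Monotone convergence for directed families of lower semicontinuous functions. -/
lemma lintegral_iSup_of_directed_lsc [BorelSpace X] {ι : Type*} [Nonempty ι]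
    (μ : Measure X) [μ.Regular] [IsFiniteMeasure μ] {g : ι → X → ℝ≥0∞}
    (hg : ∀ i, LowerSemicontinuous (g i)) (hd : Directed (· ≤ ·) g) :
    ∫⁻ x, ⨆ i, g i x ∂μ = ⨆ i, ∫⁻ x, g i x ∂μ := by
  refine le_antisymm ?_ (iSup_le fun i => lintegral_mono fun x => le_iSup (fun i => g i x) i)
  set f : X → ℝ≥0∞ := fun x => ⨆ i, g i x with hf
  set S := ⨆ i, ∫⁻ x, g i x ∂μ with hS
  have hfl : LowerSemicontinuous f := lowerSemicontinuous_iSup hg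
  have hlevel : ∀ c : ℝ≥0∞, μ {x | c < f x} = ⨆ i, μ {x | c < g i x} := by
    intro c
    have : {x | c < f x} = ⋃ i, {x | c < g i x} := by
      ext x; simp [hf, lt_iSup_iff]
    rw [this]
    refine measure_iUnion_of_directed_isOpen μ (fun i => (hg i).isOpen_preimage c) ?_
    intro i j
    obtain ⟨k, hik, hjk⟩ := hd i j
    exact ⟨k, fun x hx => lt_of_lt_of_le hx (hik x), fun x hx => lt_of_lt_of_le hx (hjk x)⟩
  have hstair : ∀ (ε : ℝ≥0∞) (n : ℕ), ∫⁻ x, staircase ε n (f x) ∂μ ≤ S := by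
    intro ε n
    rw [lintegral_staircase hfl]
    simp only [hlevel, ENNReal.mul_iSup]
    rw [ENNReal.finsetSum_iSup]
    · refine iSup_le fun i => le_iSup_of_le i ?_
      rw [← lintegral_staircase (hg i)]
      exact lintegral_mono fun x => staircase_le _ _ _
    · intro i j
      obtain ⟨k, hik, hjk⟩ := hd i j
      refine ⟨k, fun a => ⟨?_, ?_⟩⟩
      · gcongr with x; exact hik x
      · gcongr with x; exact hjk x
  have hbound : ∀ (M n : ℕ), ∫⁻ x, min (f x) M ∂μ ≤ S + (M : ℝ≥0∞) * ((n : ℝ≥0∞) + 1)⁻¹ * μ univ := by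
    intro M n
    set ε : ℝ≥0∞ := (M : ℝ≥0∞) * ((n : ℝ≥0∞) + 1)⁻¹ with hε
    have hM : ((n + 1 : ℕ) : ℝ≥0∞) * ε = M := by
      rw [hε, mul_comm, mul_assoc]
      push_cast
      rw [ENNReal.inv_mul_cancel (by simp) (by finiteness), mul_one]
    calc ∫⁻ x, min (f x) M ∂μ ≤ ∫⁻ x, (staircase ε (n + 1) (f x) + ε) ∂μ := by
          refine lintegral_mono fun x => ?_
          rw [← hM]
          exact min_le_staircase_add _ _ _
      _ = ∫⁻ x, staircase ε (n + 1) (f x) ∂μ + ε * μ univ := by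
          rw [lintegral_add_right _ measurable_const, lintegral_const]
      _ ≤ S + ε * μ univ := by gcongr; exact hstair _ _
  have hmin : ∀ M : ℕ, ∫⁻ x, min (f x) M ∂μ ≤ S := by
    intro M
    have hlim : Tendsto (fun n : ℕ => S + (M : ℝ≥0∞) * ((n : ℝ≥0∞) + 1)⁻¹ * μ univ) atTop
        (𝓝 (S + (M : ℝ≥0∞) * 0 * μ univ)) := by
      have h1 : Tendsto (fun n : ℕ => ((n : ℝ≥0∞) + 1)⁻¹) atTop (𝓝 0) := by
        have := (tendsto_add_atTop_iff_nat 1).2 ENNReal.tendsto_inv_nat_nhds_zero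
        simpa using this
      refine tendsto_const_nhds.add ?_
      refine ENNReal.Tendsto.mul_const ?_ (Or.inr (measure_ne_top μ _))
      exact ENNReal.Tendsto.const_mul h1 (Or.inr (by simp))
    simpa using ge_of_tendsto' hlim (hbound M)
  have hsup : ∀ x, f x = ⨆ M : ℕ, min (f x) M := by
    intro x
    rw [← inf_iSup_eq, ENNReal.iSup_natCast, inf_top_eq]
  calc ∫⁻ x, f x ∂μ = ∫⁻ x, ⨆ M : ℕ, min (f x) M ∂μ := by simp_rw [← hsup]
    _ = ⨆ M : ℕ, ∫⁻ x, min (f x) M ∂μ := by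
        refine lintegral_iSup (fun M => hfl.measurable.min measurable_const) ?_
        intro a b hab x
        exact min_le_min le_rfl (by exact_mod_cast hab)
    _ ≤ S := iSup_le hmin

/-- An open box `left × right` with a weight that stays below the kernel on the box. -/
structure Box (κ : X → X → ℝ≥0∞) where
  /-- The weight of the box. -/
  weight : NNReal
  /-- The first side of the box. -/
  left : Set X
  /-- The second side of the box. -/
  right : Set X
  isOpen_left : IsOpen left
  isOpen_right : IsOpen right
  weight_le : ∀ x ∈ left, ∀ y ∈ right, (weight : ℝ≥0∞) ≤ κ x y

open Classical in
/-- The weighted indicator of a box. -/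
def Box.val {κ : X → X → ℝ≥0∞} (a : Box κ) (x y : X) : ℝ≥0∞ :=
  if x ∈ a.left ∧ y ∈ a.right then (a.weight : ℝ≥0∞) else 0

/-- The upper envelope of finitely many weighted boxes. -/
def boxSup {κ : X → X → ℝ≥0∞} (F : Finset (Box κ)) (x y : X) : ℝ≥0∞ :=
  F.sup fun a => a.val x y

lemma boxSup_le {κ : X → X → ℝ≥0∞} (F : Finset (Box κ)) (x y : X) : boxSup F x y ≤ κ x y := by
  refine Finset.sup_le fun a _ => ?_
  unfold Box.val
  split_ifs with h
  · exact a.weight_le x h.1 y h.2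
  · exact zero_le

lemma boxSup_mono {κ : X → X → ℝ≥0∞} {F G : Finset (Box κ)} (h : F ⊆ G) (x y : X) :
    boxSup F x y ≤ boxSup G x y := Finset.sup_mono h

lemma eventually_boxSup_le_left {κ : X → X → ℝ≥0∞} (F : Finset (Box κ)) (x₀ : X) :
    ∀ᶠ x in 𝓝 x₀, ∀ y, boxSup F x₀ y ≤ boxSup F x y := by
  classical
  have : ∀ a ∈ F, ∀ᶠ x in 𝓝 x₀, ∀ y, a.val x₀ y ≤ a.val x y := by
    intro a _
    by_cases h : x₀ ∈ a.left
    · filter_upwards [a.isOpen_left.mem_nhds h] with x hx y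
      exact (if_congr (by simp only [h, hx]) rfl rfl).le
    · exact Eventually.of_forall fun x y => by simp [Box.val, h]
  filter_upwards [(Filter.eventually_all_finset F).2 this] with x hx y
  exact Finset.sup_mono_fun fun a ha => hx a ha y

lemma eventually_boxSup_le_right {κ : X → X → ℝ≥0∞} (F : Finset (Box κ)) (y₀ : X) :
    ∀ᶠ y in 𝓝 y₀, ∀ x, boxSup F x y₀ ≤ boxSup F x y := by
  classical
  have : ∀ a ∈ F, ∀ᶠ y in 𝓝 y₀, ∀ x, a.val x y₀ ≤ a.val x y := by
    intro a _
    by_cases h : y₀ ∈ a.right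
    · filter_upwards [a.isOpen_right.mem_nhds h] with y hy x
      exact (if_congr (by simp only [h, hy]) rfl rfl).le
    · exact Eventually.of_forall fun y x => by simp [Box.val, h]
  filter_upwards [(Filter.eventually_all_finset F).2 this] with y hy x
  exact Finset.sup_mono_fun fun a ha => hy a ha x

lemma measurable_boxSup [BorelSpace X] {κ : X → X → ℝ≥0∞} (F : Finset (Box κ)) :
    Measurable fun p : X × X => boxSup F p.1 p.2 := by
  have hm : ∀ a : Box κ, Measurable fun p : X × X => a.val p.1 p.2 := fun a =>
    Measurable.ite (a.isOpen_left.measurableSet.prod a.isOpen_right.measurableSet) measurable_const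
      measurable_const
  classical
  induction F using Finset.induction_on with
  | empty => simp [boxSup]
  | insert a F _ ih =>
    simp only [boxSup, Finset.sup_insert] at ih ⊢
    exact (hm a).sup ih

lemma iSup_boxSup {κ : X → X → ℝ≥0∞} (hκ : LowerSemicontinuous fun p : X × X => κ p.1 p.2)
    (x y : X) : ⨆ F : Finset (Box κ), boxSup F x y = κ x y := by
  refine le_antisymm (iSup_le fun F => boxSup_le F x y) ?_
  refine le_of_forall_lt fun t ht => ?_
  obtain ⟨c, htc, hc⟩ := ENNReal.lt_iff_exists_nnreal_btwn.1 ht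
  obtain ⟨U, V, hU, hx, hV, hy, hUV⟩ := mem_nhds_prod_iff'.1 (hκ (x, y) c hc)
  let a : Box κ := ⟨c, U, V, hU, hV, fun x' hx' y' hy' =>
    le_of_lt (hUV (show (x', y') ∈ U ×ˢ V from ⟨hx', hy'⟩))⟩
  refine lt_of_lt_of_le htc (le_iSup_of_le {a} ?_)
  simp [boxSup, Box.val, a, hx, hy]

lemma lowerSemicontinuous_of_eventually_le {g : X → ℝ≥0∞}
    (h : ∀ x₀, ∀ᶠ x in 𝓝 x₀, g x₀ ≤ g x) : LowerSemicontinuous g := fun x₀ _ ht =>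
  (h x₀).mono fun _ hx => lt_of_lt_of_le ht hx

lemma directed_boxSup {κ : X → X → ℝ≥0∞} {Y : Type*} {G : Finset (Box κ) → Y → ℝ≥0∞}
    (hG : ∀ F F', F ⊆ F' → G F ≤ G F') : Directed (· ≤ ·) G := by
  classical
  exact fun F F' => ⟨F ∪ F', hG _ _ Finset.subset_union_left, hG _ _ Finset.subset_union_right⟩

lemma potential_eq_iSup [BorelSpace X] {κ : X → X → ℝ≥0∞} (hκ : IsKernel κ) (ν : Measure X)
    [ν.Regular] [IsFiniteMeasure ν] (x : X) :
    potential κ ν x = ⨆ F : Finset (Box κ), ∫⁻ y, boxSup F x y ∂ν := by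
  simp only [potential, ← iSup_boxSup hκ.2]
  refine lintegral_iSup_of_directed_lsc ν (fun F => ?_) (directed_boxSup fun F F' h y => ?_)
  · exact lowerSemicontinuous_of_eventually_le fun y₀ =>
      (eventually_boxSup_le_right F y₀).mono fun y hy => hy x
  · exact boxSup_mono h x y

lemma lowerSemicontinuous_lintegral_boxSup {κ : X → X → ℝ≥0∞} (F : Finset (Box κ))
    (ν : Measure X) : LowerSemicontinuous fun x => ∫⁻ y, boxSup F x y ∂ν :=
  lowerSemicontinuous_of_eventually_le fun x₀ =>
    (eventually_boxSup_le_left F x₀).mono fun _ hx => lintegral_mono fun y => hx y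

lemma lowerSemicontinuous_potential [BorelSpace X] {κ : X → X → ℝ≥0∞} (hκ : IsKernel κ)
    (ν : Measure X) [ν.Regular] [IsFiniteMeasure ν] : LowerSemicontinuous (potential κ ν) := by
  rw [funext (potential_eq_iSup hκ ν)]
  exact lowerSemicontinuous_iSup fun F => lowerSemicontinuous_lintegral_boxSup F ν

lemma measurable_potential [BorelSpace X] {κ : X → X → ℝ≥0∞} (hκ : IsKernel κ)
    (ν : Measure X) [ν.Regular] [IsFiniteMeasure ν] : Measurable (potential κ ν) :=
  (lowerSemicontinuous_potential hκ ν).measurable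

/-- Tonelli's theorem for lower semicontinuous kernels, which need not be measurable for the
product `σ`-algebra. -/
lemma mutualEnergy_eq_lintegral_potential [BorelSpace X] {κ : X → X → ℝ≥0∞} (hκ : IsKernel κ)
    (μ ν : Measure X) [μ.Regular] [IsFiniteMeasure μ] [ν.Regular] [IsFiniteMeasure ν] :
    mutualEnergy κ μ ν = ∫⁻ x, potential κ ν x ∂μ := by
  refine le_antisymm (lintegral_prod_le _) ?_
  simp_rw [potential_eq_iSup hκ]
  rw [lintegral_iSup_of_directed_lsc μ (fun F => lowerSemicontinuous_lintegral_boxSup F ν)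
    (directed_boxSup fun F F' h x => lintegral_mono fun y => boxSup_mono h x y)]
  refine iSup_le fun F => ?_
  rw [← lintegral_prod (fun p : X × X => boxSup F p.1 p.2) (measurable_boxSup F).aemeasurable]
  exact lintegral_mono fun p => boxSup_le F p.1 p.2

/-- A regular finite measure of finite energy. -/
structure FinEnergy (κ : X → X → ℝ≥0∞) (μ : Measure X) : Prop where
  regular : μ.Regular
  finite : IsFiniteMeasure μ
  energy_lt_top : energy κ μ < ⊤

lemma FinEnergy.mem {κ : X → X → ℝ≥0∞} {μ : Measure X} (h : FinEnergy κ μ) :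
    memEplus κ μ := ⟨h.regular, h.energy_lt_top⟩

/-- The mutual energy as a real number. -/
def pairing (κ : X → X → ℝ≥0∞) (μ ν : Measure X) : ℝ := (mutualEnergy κ μ ν).toReal

section Algebra

variable [T2Space X] [LocallyCompactSpace X] [BorelSpace X] {κ : X → X → ℝ≥0∞}

lemma mutualEnergy_comm (hκ : IsKernel κ) (μ ν : Measure X) [IsFiniteMeasure μ]
    [IsFiniteMeasure ν] : mutualEnergy κ μ ν = mutualEnergy κ ν μ := by
  unfold mutualEnergy
  rw [← Measure.prod_swap]
  change ∫⁻ p, κ p.1 p.2 ∂(Measure.map MeasurableEquiv.prodComm (ν.prod μ)) = _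
  rw [lintegral_map_equiv]
  exact lintegral_congr fun p => hκ.1 _ _

lemma mutualEnergy_ne_top (hE : EnergyPrinciple κ) {μ ν : Measure X} (hμ : memEplus κ μ)
    (hν : memEplus κ ν) : mutualEnergy κ μ ν ≠ ⊤ := by
  have h := (hE μ ν hμ hν).1
  have h' : energy κ μ + energy κ ν < ⊤ := ENNReal.add_lt_top.2 ⟨hμ.2, hν.2⟩
  intro htop
  rw [htop] at h
  simp at h
  exact h.elim hμ.2.ne hν.2.ne

lemma mutualEnergy_add_left (μ μ' ν : Measure X) [IsFiniteMeasure μ] [IsFiniteMeasure μ']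
    [IsFiniteMeasure ν] :
    mutualEnergy κ (μ + μ') ν = mutualEnergy κ μ ν + mutualEnergy κ μ' ν := by
  unfold mutualEnergy
  rw [Measure.add_prod, lintegral_add_measure]

lemma mutualEnergy_smul_left (c : ℝ≥0∞) (μ ν : Measure X) [IsFiniteMeasure ν] :
    mutualEnergy κ (c • μ) ν = c * mutualEnergy κ μ ν := by
  unfold mutualEnergy
  rw [Measure.prod_smul_left, lintegral_smul_measure, smul_eq_mul]

lemma mutualEnergy_smul_right (c : ℝ≥0∞) (μ ν : Measure X) [IsFiniteMeasure ν] :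
    mutualEnergy κ μ (c • ν) = c * mutualEnergy κ μ ν := by
  unfold mutualEnergy
  rw [Measure.prod_smul_right, lintegral_smul_measure, smul_eq_mul]

lemma mutualEnergy_zero_right (μ : Measure X) : mutualEnergy κ μ 0 = 0 := by
  simp [mutualEnergy]

lemma eq_zero_of_energy_eq_zero (hE : EnergyPrinciple κ) {μ : Measure X} (hμ : IsRadon μ)
    (h : energy κ μ = 0) : μ = 0 := by
  have h0 : energy κ (0 : Measure X) = 0 := mutualEnergy_zero_right 0
  refine (hE μ 0 ⟨hμ, by simp [h]⟩ ⟨Measure.Regular.zero, by simp [h0]⟩).2 ?_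
  rw [mutualEnergy_zero_right, h, h0]
  simp

lemma FinEnergy.smul {μ : Measure X} (h : FinEnergy κ μ) {c : ℝ≥0∞} (hc : c ≠ ⊤) :
    FinEnergy κ (c • μ) := by
  have := h.regular
  have := h.finite
  have hfin := Measure.smul_finite μ hc
  refine ⟨Measure.Regular.smul hc, hfin, ?_⟩
  rw [energy, mutualEnergy_smul_left, mutualEnergy_smul_right]
  exact ENNReal.mul_lt_top hc.lt_top (ENNReal.mul_lt_top hc.lt_top h.energy_lt_top)

lemma FinEnergy.add (hκ : IsKernel κ) (hE : EnergyPrinciple κ) {μ ν : Measure X}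
    (hμ : FinEnergy κ μ) (hν : FinEnergy κ ν) : FinEnergy κ (μ + ν) := by
  have := hμ.regular
  have := hμ.finite
  have := hν.regular
  have := hν.finite
  refine ⟨inferInstance, inferInstance, ?_⟩
  have h := mutualEnergy_ne_top hE hμ.mem hν.mem
  rw [energy, mutualEnergy_add_left, mutualEnergy_comm hκ μ, mutualEnergy_comm hκ ν,
    mutualEnergy_add_left, mutualEnergy_add_left, mutualEnergy_comm hκ ν μ]
  have h1 : mutualEnergy κ μ μ ≠ ⊤ := hμ.energy_lt_top.ne
  have h2 : mutualEnergy κ ν ν ≠ ⊤ := hν.energy_lt_top.ne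
  finiteness

lemma energy_restrict_le (hE : EnergyPrinciple κ) {μ : Measure X} (hμ : IsRadon μ)
    {s : Set X} (hμs : μ s ≠ ⊤) :
    energy κ (μ.restrict s) ≤ energy κ μ := by
  by_cases hm : AEMeasurable (fun x => Measure.map (Prod.mk x) μ) μ
  · have : IsFiniteMeasure (μ.restrict s) := ⟨by simpa using hμs.lt_top⟩
    refine lintegral_mono' (Measure.le_iff.2 fun t ht => ?_) le_rfl
    rw [Measure.prod_apply ht, Measure.prod, Measure.bind_apply ht hm]
    refine (lintegral_mono' Measure.restrict_le_self fun x => ?_)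
    rw [Measure.map_apply measurable_prodMk_left ht]
    exact Measure.restrict_apply_le _ _
  · have : energy κ μ = 0 := by
      rw [energy, mutualEnergy, Measure.prod, Measure.bind, Measure.map_of_not_aemeasurable hm]
      simp
    rw [eq_zero_of_energy_eq_zero hE hμ this]
    simp

lemma FinEnergy.of_restrict (hE : EnergyPrinciple κ) {μ : Measure X} (hμ : memEplus κ μ)
    {s : Set X} (hμs : μ s ≠ ⊤) : FinEnergy κ (μ.restrict s) := by
  have : μ.Regular := hμ.1
  exact ⟨Measure.Regular.restrict_of_measure_ne_top hμs, ⟨by simpa using hμs.lt_top⟩,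
    (energy_restrict_le hE hμ.1 hμs).trans_lt hμ.2⟩

lemma pairing_comm (hκ : IsKernel κ) {μ ν : Measure X} (hμ : FinEnergy κ μ)
    (hν : FinEnergy κ ν) : pairing κ μ ν = pairing κ ν μ := by
  have := hμ.finite
  have := hν.finite
  rw [pairing, mutualEnergy_comm hκ, pairing]

lemma pairing_add_left (hE : EnergyPrinciple κ) {μ μ' ν : Measure X} (hμ : FinEnergy κ μ)
    (hμ' : FinEnergy κ μ') (hν : FinEnergy κ ν) :
    pairing κ (μ + μ') ν = pairing κ μ ν + pairing κ μ' ν := by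
  have := hμ.finite
  have := hμ'.finite
  have := hν.finite
  rw [pairing, mutualEnergy_add_left, ENNReal.toReal_add
    (mutualEnergy_ne_top hE hμ.mem hν.mem)
    (mutualEnergy_ne_top hE hμ'.mem hν.mem), pairing, pairing]

lemma pairing_add_right (hκ : IsKernel κ) (hE : EnergyPrinciple κ) {μ μ' ν : Measure X}
    (hμ : FinEnergy κ μ) (hμ' : FinEnergy κ μ') (hν : FinEnergy κ ν) :
    pairing κ ν (μ + μ') = pairing κ ν μ + pairing κ ν μ' := by
  rw [pairing_comm hκ hν (hμ.add hκ hE hμ'), pairing_add_left hE hμ hμ' hν, pairing_comm hκ hμ hν,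
    pairing_comm hκ hμ' hν]

lemma pairing_smul_left {μ ν : Measure X} (c : ℝ≥0∞) (hν : FinEnergy κ ν) :
    pairing κ (c • μ) ν = c.toReal * pairing κ μ ν := by
  have := hν.finite
  rw [pairing, mutualEnergy_smul_left, ENNReal.toReal_mul, pairing]

lemma pairing_smul_right {μ ν : Measure X} (c : ℝ≥0∞) (hν : FinEnergy κ ν) :
    pairing κ μ (c • ν) = c.toReal * pairing κ μ ν := by
  have := hν.finite
  rw [pairing, mutualEnergy_smul_right, ENNReal.toReal_mul, pairing]

/-- The energy of `a • μ + b • ν`. -/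
lemma pairing_combination (hκ : IsKernel κ) (hE : EnergyPrinciple κ) {μ ν : Measure X}
    (hμ : FinEnergy κ μ) (hν : FinEnergy κ ν) {a b : ℝ≥0∞} (ha : a ≠ ⊤) (hb : b ≠ ⊤) :
    pairing κ (a • μ + b • ν) (a • μ + b • ν) =
      a.toReal ^ 2 * pairing κ μ μ + 2 * a.toReal * b.toReal * pairing κ μ ν
        + b.toReal ^ 2 * pairing κ ν ν := by
  have h1 := hμ.smul ha
  have h2 := hν.smul hb
  have h3 := h1.add hκ hE h2
  rw [pairing_add_left hE h1 h2 h3, pairing_smul_left _ h3, pairing_smul_left _ h3,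
    pairing_add_right hκ hE h1 h2 hμ, pairing_add_right hκ hE h1 h2 hν, pairing_smul_right _ hμ,
    pairing_smul_right _ hμ, pairing_smul_right _ hν, pairing_smul_right _ hν,
    pairing_comm hκ hν hμ]
  ring

/-- The squared strong distance. -/
def distSq (κ : X → X → ℝ≥0∞) (μ ν : Measure X) : ℝ :=
  pairing κ μ μ + pairing κ ν ν - 2 * pairing κ μ ν

lemma distSq_nonneg (hE : EnergyPrinciple κ) {μ ν : Measure X} (hμ : FinEnergy κ μ)
    (hν : FinEnergy κ ν) : 0 ≤ distSq κ μ ν := by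
  have h := (hE μ ν hμ.mem hν.mem).1
  have h' := ENNReal.toReal_mono (ENNReal.add_ne_top.2 ⟨hμ.energy_lt_top.ne, hν.energy_lt_top.ne⟩) h
  rw [ENNReal.toReal_add hμ.energy_lt_top.ne hν.energy_lt_top.ne, ENNReal.toReal_mul] at h'
  simp only [distSq, pairing]
  simp only [energy, ENNReal.toReal_ofNat] at h'
  linarith

lemma eq_of_distSq_le_zero (hE : EnergyPrinciple κ) {μ ν : Measure X} (hμ : FinEnergy κ μ)
    (hν : FinEnergy κ ν) (h : distSq κ μ ν ≤ 0) : μ = ν := by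
  refine (hE μ ν hμ.mem hν.mem).2 ?_
  have h' := le_antisymm h (distSq_nonneg hE hμ hν)
  have htop := mutualEnergy_ne_top hE hμ.mem hν.mem
  rw [← ENNReal.toReal_eq_toReal_iff' (by finiteness)
    (ENNReal.add_ne_top.2 ⟨hμ.energy_lt_top.ne, hν.energy_lt_top.ne⟩),
    ENNReal.toReal_add hμ.energy_lt_top.ne hν.energy_lt_top.ne,
    ENNReal.toReal_mul]
  simp only [distSq, pairing] at h'
  simp only [energy, ENNReal.toReal_ofNat]
  linarith

lemma pairing_sub_sq_le (hκ : IsKernel κ) (hE : EnergyPrinciple κ) {μ μ' ν : Measure X}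
    (hμ : FinEnergy κ μ) (hμ' : FinEnergy κ μ') (hν : FinEnergy κ ν) :
    (pairing κ μ ν - pairing κ μ' ν) ^ 2 ≤ distSq κ μ μ' * pairing κ ν ν := by
  have key : ∀ {a b : Measure X}, FinEnergy κ a → FinEnergy κ b → ∀ t : ℝ, 0 ≤ t →
      0 ≤ distSq κ a b + 2 * t * (pairing κ a ν - pairing κ b ν) + t ^ 2 * pairing κ ν ν := by
    intro a b ha hb t ht
    have hs : FinEnergy κ (ENNReal.ofReal t • ν) := hν.smul ENNReal.ofReal_ne_top
    have h := distSq_nonneg hE (ha.add hκ hE hs) hb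
    have hc := pairing_combination hκ hE ha hν ENNReal.one_ne_top (b := ENNReal.ofReal t)
      ENNReal.ofReal_ne_top
    rw [one_smul] at hc
    rw [distSq, hc, pairing_add_left hE ha hs hb, pairing_smul_left _ hb,
      ENNReal.toReal_ofReal ht, pairing_comm hκ hν hb] at h
    rw [distSq]
    simp only [ENNReal.toReal_one] at h
    linarith
  have hsymm : distSq κ μ' μ = distSq κ μ μ' := by
    simp only [distSq, pairing_comm hκ hμ' hμ]; ring
  have hd := discrim_le_zero (a := pairing κ ν ν) (b := 2 * (pairing κ μ ν - pairing κ μ' ν))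
    (c := distSq κ μ μ') fun t => by
      rcases le_total 0 t with ht | ht
      · have := key hμ hμ' t ht
        linarith
      · have := key hμ' hμ (-t) (by linarith)
        rw [hsymm] at this
        linarith
  rw [discrim] at hd
  linarith

lemma pairing_sq_le (hκ : IsKernel κ) (hE : EnergyPrinciple κ) {μ ν : Measure X}
    (hμ : FinEnergy κ μ) (hν : FinEnergy κ ν) :
    pairing κ μ ν ^ 2 ≤ pairing κ μ μ * pairing κ ν ν := by
  have h0 : FinEnergy κ ((0 : ℝ≥0∞) • μ) := hμ.smul ENNReal.zero_ne_top
  have h := pairing_sub_sq_le hκ hE hμ h0 hν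
  simpa only [distSq, pairing_smul_left _ hν, pairing_smul_left _ h0, pairing_smul_right _ hμ,
    ENNReal.toReal_zero, zero_mul, mul_zero, sub_zero, add_zero] using h

lemma tendsto_distSq {μ : ℕ → Measure X} {μ₀ : Measure X}
    (hE : EnergyPrinciple κ) (hμ : ∀ n, FinEnergy κ (μ n)) (hμ₀ : FinEnergy κ μ₀)
    (h : StrongTendstoSeq κ μ μ₀) : Tendsto (fun n => distSq κ (μ n) μ₀) atTop (𝓝 0) := by
  have h2 := h.pow 2
  refine (h2.congr fun n => ?_).trans (by simp)
  rw [strongDist, Real.sq_sqrt]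
  · rfl
  · exact distSq_nonneg hE (hμ n) hμ₀

lemma tendsto_pairing {μ : ℕ → Measure X} {μ₀ ν : Measure X} (hκ : IsKernel κ)
    (hE : EnergyPrinciple κ) (hμ : ∀ n, FinEnergy κ (μ n)) (hμ₀ : FinEnergy κ μ₀)
    (hν : FinEnergy κ ν) (h : StrongTendstoSeq κ μ μ₀) :
    Tendsto (fun n => pairing κ (μ n) ν) atTop (𝓝 (pairing κ μ₀ ν)) := by
  have hd := ((tendsto_distSq hE hμ hμ₀ h).mul_const (pairing κ ν ν)).sqrt
  rw [zero_mul, Real.sqrt_zero] at hd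
  refine tendsto_iff_dist_tendsto_zero.2 (squeeze_zero (fun _ => dist_nonneg) (fun n => ?_) hd)
  rw [Real.dist_eq]
  exact Real.abs_le_sqrt (pairing_sub_sq_le hκ hE (hμ n) hμ₀ hν)

lemma tendsto_pairing_self {μ : ℕ → Measure X} {μ₀ : Measure X} (hκ : IsKernel κ)
    (hE : EnergyPrinciple κ) (hμ : ∀ n, FinEnergy κ (μ n)) (hμ₀ : FinEnergy κ μ₀)
    (h : StrongTendstoSeq κ μ μ₀) :
    Tendsto (fun n => pairing κ (μ n) (μ n)) atTop (𝓝 (pairing κ μ₀ μ₀)) := by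
  have h1 := (tendsto_distSq hE hμ hμ₀ h).add
    ((tendsto_pairing hκ hE hμ hμ₀ hμ₀ h).const_mul 2 |>.sub_const (pairing κ μ₀ μ₀))
  refine (h1.congr fun n => ?_).trans (by ring_nf; rfl)
  rw [distSq]
  ring

end Algebra

section Vague

variable [T2Space X] [LocallyCompactSpace X] [BorelSpace X]

lemma measure_le_ofReal_integral (μ : Measure X) [μ.Regular] {C : Set X} (hC : IsCompact C)
    {φ : X → ℝ} (hφ : Continuous φ) (hc : HasCompactSupport φ) (h0 : ∀ x, 0 ≤ φ x)
    (h1 : ∀ x ∈ C, φ x = 1) : μ C ≤ ENNReal.ofReal (∫ x, φ x ∂μ) := by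
  rw [ofReal_integral_eq_lintegral_ofReal (hφ.integrable_of_hasCompactSupport hc)
    (ae_of_all _ h0), ← lintegral_indicator_one hC.measurableSet]
  refine lintegral_mono fun x => ?_
  by_cases hx : x ∈ C
  · simp [hx, h1 x hx]
  · simp [hx]

lemma integral_le_measureReal_univ (μ : Measure X) [IsFiniteMeasure μ] {φ : X → ℝ}
    (h0 : ∀ x, 0 ≤ φ x) (h1 : ∀ x, φ x ≤ 1) : ∫ x, φ x ∂μ ≤ μ.real univ := by
  have := integral_mono_of_nonneg (ae_of_all μ h0) (integrable_const (1 : ℝ)) (ae_of_all μ h1)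
  simpa using this

lemma measure_univ_le_of_isCompact (μ : Measure X) [μ.Regular] {M : ℝ≥0∞}
    (h : ∀ C, IsCompact C → μ C ≤ M) : μ univ ≤ M := by
  rw [isOpen_univ.measure_eq_iSup_isCompact]
  exact iSup₂_le fun C _ => iSup_le fun hC => h C hC

lemma measure_univ_le_one_of_vague {μ : ℕ → Measure X} {μ₀ : Measure X} [μ₀.Regular]
    (hμ : ∀ n, μ n univ ≤ 1) (h : VagueTendstoSeq μ μ₀) : μ₀ univ ≤ 1 := by
  refine measure_univ_le_of_isCompact μ₀ fun C hC => ?_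
  obtain ⟨φ, h1, -, hc, h01⟩ := exists_continuous_one_zero_of_isCompact hC isClosed_empty
    (disjoint_empty C)
  refine (measure_le_ofReal_integral μ₀ hC φ.continuous hc (fun x => (h01 x).1) h1).trans ?_
  refine ENNReal.ofReal_le_one.2 (le_of_tendsto' (h φ φ.continuous hc) fun n => ?_)
  have : IsFiniteMeasure (μ n) := ⟨(hμ n).trans_lt ENNReal.one_lt_top⟩
  refine (integral_le_measureReal_univ (μ n) (fun x => (h01 x).1) fun x => (h01 x).2).trans ?_
  exact ENNReal.toReal_le_of_le_ofReal zero_le_one (by simpa using hμ n)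

lemma measure_compl_eq_zero_of_vague {μ : ℕ → Measure X} {μ₀ : Measure X} [μ₀.Regular]
    {K : Set X} (hK : IsCompact K) (hμ : ∀ n, μ n Kᶜ = 0) (h : VagueTendstoSeq μ μ₀) :
    μ₀ Kᶜ = 0 := by
  rw [hK.isClosed.isOpen_compl.measure_eq_iSup_isCompact]
  refine le_antisymm (iSup₂_le fun C hCK => iSup_le fun hC => ?_) zero_le
  obtain ⟨φ, h1, h0, hc, h01⟩ := exists_continuous_one_zero_of_isCompact hC hK.isClosed
    (disjoint_left.2 fun x hx => hCK hx)
  refine (measure_le_ofReal_integral μ₀ hC φ.continuous hc (fun x => (h01 x).1) h1).trans ?_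
  refine (ENNReal.ofReal_eq_zero.2 (le_of_tendsto' (h φ φ.continuous hc) fun n => ?_)).le
  refine (integral_eq_zero_of_ae ?_).le
  refine ae_iff.2 (measure_mono_null (fun x hx => ?_) (hμ n))
  exact fun hxK => hx (h0 hxK)

lemma measure_univ_eq_one_of_vague {μ : ℕ → Measure X} {μ₀ : Measure X} [μ₀.Regular]
    {K : Set X} (hK : IsCompact K) (hμ : ∀ n, μ n Kᶜ = 0) (hμ1 : ∀ n, μ n univ = 1)
    (h : VagueTendstoSeq μ μ₀) : μ₀ univ = 1 := by
  refine le_antisymm (measure_univ_le_one_of_vague (fun n => (hμ1 n).le) h) ?_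
  have hle := measure_univ_le_one_of_vague (fun n => (hμ1 n).le) h
  have : IsFiniteMeasure μ₀ := ⟨hle.trans_lt ENNReal.one_lt_top⟩
  obtain ⟨φ, h1, -, hc, h01⟩ := exists_continuous_one_zero_of_isCompact hK isClosed_empty
    (disjoint_empty K)
  have hφ : 1 ≤ ∫ x, φ x ∂μ₀ := by
    refine ge_of_tendsto' (h φ φ.continuous hc) fun n => ?_
    have : ∫ x, φ x ∂μ n = ∫ _, (1 : ℝ) ∂μ n :=
      integral_congr_ae (ae_iff.2 (measure_mono_null (fun x hx hxK => hx (h1 hxK)) (hμ n)))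
    simp [this, Measure.real, hμ1 n]
  have h2 := hφ.trans (integral_le_measureReal_univ μ₀ (fun x => (h01 x).1) fun x => (h01 x).2)
  rw [Measure.real] at h2
  simpa using ENNReal.ofReal_le_of_le_toReal h2

end Vague

section Concentration

variable [T2Space X] [LocallyCompactSpace X] [BorelSpace X] {κ : X → X → ℝ≥0∞}

lemma Concentrated.measure_compl {ν : Measure X} [ν.Regular] [IsFiniteMeasure ν] {A : Set X}
    (h : Concentrated ν A) : ν Aᶜ = 0 := by
  refine le_antisymm (_root_.le_of_forall_pos_le_add fun ε hε => ?_) zero_le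
  obtain ⟨K, -, hK, hlt⟩ := (MeasurableSet.univ (α := X)).exists_isCompact_sdiff_lt
    (measure_ne_top ν _) hε.ne'
  calc ν Aᶜ ≤ ν ((Aᶜ ∩ K) ∪ (univ \ K)) := measure_mono fun x hx => by
        by_cases hxK : x ∈ K
        · exact Or.inl ⟨hx, hxK⟩
        · exact Or.inr ⟨mem_univ x, hxK⟩
    _ ≤ ν (Aᶜ ∩ K) + ν (univ \ K) := measure_union_le _ _
    _ ≤ 0 + ε := add_le_add (h K hK).le hlt.le

lemma concentrated_of_measure_compl {ν : Measure X} {A : Set X} (h : ν Aᶜ = 0) :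
    Concentrated ν A := fun _ _ => measure_mono_null inter_subset_left h

lemma exists_isCompact_subset_inter {ν : Measure X} [ν.Regular] [IsFiniteMeasure ν] {A B : Set X}
    (h : Concentrated ν A) (hB : MeasurableSet B) {c : ℝ≥0∞} (hc : c < ν B) :
    ∃ K, IsCompact K ∧ K ⊆ A ∩ B ∧ c < ν K := by
  set D := B \ toMeasurable ν Aᶜ with hD
  have h0 : ν (toMeasurable ν Aᶜ) = 0 := (measure_toMeasurable _).trans h.measure_compl
  have hDB : ν D = ν B := measure_sdiff_null h0
  have hDm : MeasurableSet D := hB.diff (measurableSet_toMeasurable ν Aᶜ)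
  obtain ⟨K, hKD, hK, hlt⟩ := hDm.exists_lt_isCompact_of_ne_top (measure_ne_top ν _) (hDB ▸ hc : c < ν D)
  refine ⟨K, hK, fun x hx => ⟨?_, (hKD hx).1⟩, hlt⟩
  by_contra hxA
  exact (hKD hx).2 (subset_toMeasurable ν Aᶜ hxA)

lemma Concentrated.restrict {ν : Measure X} {A : Set X} (h : Concentrated ν A) (s : Set X) :
    Concentrated (ν.restrict s) A := fun K hK =>
  le_antisymm ((Measure.restrict_apply_le _ _).trans (h K hK).le) zero_le

lemma Concentrated.mono {ν : Measure X} {A B : Set X} (h : Concentrated ν A) (hAB : A ⊆ B) :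
    Concentrated ν B := fun K hK =>
  measure_mono_null (inter_subset_inter_left _ (compl_subset_compl.2 hAB)) (h K hK)

lemma concentrated_restrict_isCompact (ν : Measure X) {K : Set X} (hK : IsCompact K) :
    Concentrated (ν.restrict K) K :=
  concentrated_of_measure_compl (by rw [Measure.restrict_apply hK.measurableSet.compl]; simp)

lemma Concentrated.smul {ν : Measure X} {A : Set X} (h : Concentrated ν A) (c : ℝ≥0∞) :
    Concentrated (c • ν) A := fun K hK => by simp [h K hK]

lemma Concentrated.add {μ ν : Measure X} {A : Set X} (hμ : Concentrated μ A)
    (hν : Concentrated ν A) : Concentrated (μ + ν) A := fun K hK => by simp [hμ K hK, hν K hK]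

lemma memBreve.finEnergy {A : Set X} {μ : Measure X} (h : memBreve κ A μ) : FinEnergy κ μ :=
  ⟨h.1.1, ⟨by simp [h.2.2]⟩, h.1.2⟩

lemma memBreve.mono {A B : Set X} {μ : Measure X} (h : memBreve κ A μ) (hAB : A ⊆ B) :
    memBreve κ B μ := ⟨h.1, h.2.1.mono hAB, h.2.2⟩

/-- Normalization of a nonzero measure of finite mass and energy. -/
lemma FinEnergy.normalize {A : Set X} {μ : Measure X} (h : FinEnergy κ μ) (hA : Concentrated μ A)
    (h0 : μ univ ≠ 0) : memBreve κ A ((μ univ)⁻¹ • μ) := by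
  have := h.finite
  refine ⟨(h.smul (ENNReal.inv_ne_top.2 h0)).mem, hA.smul _, ?_⟩
  simp [ENNReal.inv_mul_cancel h0 (measure_ne_top μ _)]

lemma wcap_ne_top_of_measure_ne_zero (hE : EnergyPrinciple κ) {ν : Measure X}
    (hν : FinEnergy κ ν) {K B : Set X} (hK : IsCompact K) (hKB : K ⊆ B) (h0 : ν K ≠ 0) :
    wcap κ B ≠ ⊤ := by
  have := hν.finite
  have hr : FinEnergy κ (ν.restrict K) := FinEnergy.of_restrict hE hν.mem (measure_ne_top _ _)
  have hb := hr.normalize ((concentrated_restrict_isCompact ν hK).mono hKB) (by simpa using h0)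
  exact ((iInf₂_le _ hb).trans_lt hb.1.2).ne

lemma measure_eq_zero_of_nearlyEverywhere (hE : EnergyPrinciple κ) {A B : Set X} {P : X → Prop}
    (hP : NearlyEverywhere κ A P) {ν : Measure X} (hν : FinEnergy κ ν) (hA : Concentrated ν A)
    (hB : MeasurableSet B) (hAB : ∀ x ∈ A, x ∈ B → ¬ P x) : ν B = 0 := by
  have := hν.regular
  have := hν.finite
  by_contra h0
  obtain ⟨K, hK, hKB, hlt⟩ := exists_isCompact_subset_inter hA hB (pos_iff_ne_zero.2 h0)
  refine wcap_ne_top_of_measure_ne_zero hE hν hK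
    (fun x hx => ⟨(hKB hx).1, hAB x (hKB hx).1 (hKB hx).2⟩ : K ⊆ {x ∈ A | ¬ P x}) hlt.ne' ?_
  exact ENNReal.inv_eq_zero.1 hP

end Concentration

section Minimizer

variable [T2Space X] [LocallyCompactSpace X] [BorelSpace X] {κ : X → X → ℝ≥0∞}

lemma memBreve.combination (hκ : IsKernel κ) (hE : EnergyPrinciple κ) {B : Set X}
    {μ ν : Measure X} (hμ : memBreve κ B μ) (hν : memBreve κ B ν) {a b : ℝ≥0∞}
    (hab : a + b = 1) : memBreve κ B (a • μ + b • ν) := by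
  have ha : a ≠ ⊤ := ne_top_of_le_ne_top ENNReal.one_ne_top (hab ▸ le_self_add)
  have hb : b ≠ ⊤ := ne_top_of_le_ne_top ENNReal.one_ne_top (hab ▸ le_add_self)
  refine ⟨((hμ.finEnergy.smul ha).add hκ hE (hν.finEnergy.smul hb)).mem,
    (hμ.2.1.smul a).add (hν.2.1.smul b), ?_⟩
  simp [hμ.2.2, hν.2.2, hab]

lemma memBreve.wcap_le {B : Set X} {ν : Measure X} (hν : memBreve κ B ν) :
    (wcap κ B).toReal ≤ pairing κ ν ν :=
  ENNReal.toReal_mono hν.1.2.ne (iInf₂_le ν hν)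

lemma exists_tendsto_wcap {B : Set X} (hw : wcap κ B ≠ ⊤) :
    ∃ μ : ℕ → Measure X, (∀ n, memBreve κ B (μ n)) ∧
      Tendsto (fun n => pairing κ (μ n) (μ n)) atTop (𝓝 (wcap κ B).toReal) := by
  have h : ∀ n : ℕ, ∃ μ, memBreve κ B μ ∧ pairing κ μ μ ≤ (wcap κ B).toReal + 1 / (n + 1) := by
    intro n
    have hn : (0 : ℝ) < 1 / (n + 1) := by positivity
    have hlt : wcap κ B < wcap κ B + ENNReal.ofReal (1 / (n + 1)) :=
      ENNReal.lt_add_right hw (ENNReal.ofReal_pos.2 hn).ne'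
    rw [wcap] at hlt
    simp only [iInf_lt_iff] at hlt
    obtain ⟨μ, hμ, hle⟩ := hlt
    refine ⟨μ, hμ, ?_⟩
    have := ENNReal.toReal_mono (ENNReal.add_ne_top.2 ⟨hw, ENNReal.ofReal_ne_top⟩) hle.le
    rwa [ENNReal.toReal_add hw ENNReal.ofReal_ne_top, ENNReal.toReal_ofReal hn.le] at this
  choose μ hμ hle using h
  refine ⟨μ, hμ, tendsto_of_tendsto_of_tendsto_of_le_of_le tendsto_const_nhds ?_
    (fun n => (hμ n).wcap_le) hle⟩
  simpa using tendsto_one_div_add_atTop_nhds_zero_nat.const_add (wcap κ B).toReal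

lemma distSq_le_of_memBreve (hκ : IsKernel κ) (hE : EnergyPrinciple κ) {B : Set X}
    {μ ν : Measure X} (hμ : memBreve κ B μ) (hν : memBreve κ B ν) :
    distSq κ μ ν ≤ 2 * (pairing κ μ μ - (wcap κ B).toReal)
      + 2 * (pairing κ ν ν - (wcap κ B).toReal) := by
  have h := (hμ.combination hκ hE hν ENNReal.inv_two_add_inv_two).wcap_le
  rw [pairing_combination hκ hE hμ.finEnergy hν.finEnergy (by simp) (by simp)] at h
  simp only [ENNReal.toReal_inv, ENNReal.toReal_ofNat] at h
  rw [distSq]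
  linarith

lemma strongCauchySeq_of_tendsto_wcap (hκ : IsKernel κ) (hE : EnergyPrinciple κ) {B : Set X}
    {μ : ℕ → Measure X} (hμ : ∀ n, memBreve κ B (μ n))
    (hlim : Tendsto (fun n => pairing κ (μ n) (μ n)) atTop (𝓝 (wcap κ B).toReal)) :
    StrongCauchySeq κ μ := by
  intro ε hε
  obtain ⟨N, hN⟩ := eventually_atTop.1 (hlim.eventually_lt_const
    (show (wcap κ B).toReal < (wcap κ B).toReal + ε ^ 2 / 4 by
      have : 0 < ε ^ 2 := by positivity
      linarith))
  refine ⟨N, fun m hm n hn => ?_⟩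
  rw [strongDist, Real.sqrt_lt' hε]
  have h1 := distSq_le_of_memBreve hκ hE (hμ m) (hμ n)
  have h2 := hN m hm
  have h3 := hN n hn
  rw [distSq] at h1
  simp only [pairing] at h1 h2 h3
  simp only [energy]
  linarith

/-- A minimizing sequence of the energy problem converges strongly, and its limit satisfies the
variational inequality. -/
lemma exists_strongLimit_of_tendsto_wcap (hκ : IsKernel κ) (hP : IsPerfect κ) {B : Set X}
    {μ : ℕ → Measure X} (hμ : ∀ n, memBreve κ B (μ n))
    (hlim : Tendsto (fun n => pairing κ (μ n) (μ n)) atTop (𝓝 (wcap κ B).toReal)) :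
    ∃ μ₀, FinEnergy κ μ₀ ∧ StrongTendstoSeq κ μ μ₀ ∧ VagueTendstoSeq μ μ₀ ∧
      pairing κ μ₀ μ₀ = (wcap κ B).toReal ∧
      ∀ ν, memBreve κ B ν → (wcap κ B).toReal ≤ pairing κ μ₀ ν := by
  obtain ⟨hE, hcomplete, hvague⟩ := hP
  obtain ⟨μ₀, hμ₀, hst⟩ := hcomplete μ (fun n => (hμ n).1)
    (strongCauchySeq_of_tendsto_wcap hκ hE hμ hlim)
  have hv := hvague μ μ₀ (fun n => (hμ n).1) hμ₀ hst
  have : μ₀.Regular := hμ₀.1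
  have hfin : FinEnergy κ μ₀ := ⟨hμ₀.1, ⟨(measure_univ_le_one_of_vague
    (fun n => (hμ n).2.2.le) hv).trans_lt ENNReal.one_lt_top⟩, hμ₀.2⟩
  have hfn := fun n => (hμ n).finEnergy
  refine ⟨μ₀, hfin, hst, hv, tendsto_nhds_unique
    (tendsto_pairing_self hκ hE hfn hfin hst) hlim, fun ν hν => ?_⟩
  set w := (wcap κ B).toReal
  set p := pairing κ μ₀ ν with hp
  have key : ∀ t : ℝ, 0 ≤ t → t ≤ 1 →
      w ≤ (1 - t) ^ 2 * w + 2 * (1 - t) * t * p + t ^ 2 * pairing κ ν ν := by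
    intro t h0 h1
    have hpl := tendsto_pairing hκ hE hfn hfin hν.finEnergy hst
    refine ge_of_tendsto' (((hlim.const_mul ((1 - t) ^ 2)).add (hpl.const_mul
      (2 * (1 - t) * t))).add_const (t ^ 2 * pairing κ ν ν)) fun n => ?_
    have h := ((hμ n).combination hκ hE hν (a := ENNReal.ofReal (1 - t)) (b := ENNReal.ofReal t)
      (by rw [← ENNReal.ofReal_add (by linarith) h0]; simp)).wcap_le
    rw [pairing_combination hκ hE (hfn n) hν.finEnergy ENNReal.ofReal_ne_top
      ENNReal.ofReal_ne_top, ENNReal.toReal_ofReal h0, ENNReal.toReal_ofReal (by linarith)] at h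
    exact h
  by_contra! hlt
  set D := w - 2 * p + pairing κ ν ν with hD
  have hpos : 0 < |D| + 1 + (w - p) := by linarith [abs_nonneg D]
  set t := (w - p) / (|D| + 1 + (w - p)) with ht
  have ht0 : 0 < t := div_pos (by linarith) hpos
  have ht1 : t ≤ 1 := (div_le_one hpos).2 (by linarith [abs_nonneg D])
  have hmul : t * (|D| + 1 + (w - p)) = w - p := div_mul_cancel₀ _ hpos.ne'
  have h1 := key t ht0.le ht1
  have h2 : t * (2 * (w - p)) ≤ t * (t * D) := by rw [hD]; linarith
  have h3 := le_of_mul_le_mul_left h2 ht0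
  have h4 : t * D ≤ t * |D| := mul_le_mul_of_nonneg_left (le_abs_self D) ht0.le
  have h5 : 0 ≤ t * (1 + (w - p)) := mul_nonneg ht0.le (by linarith)
  linarith

end Minimizer

section Equilibrium

variable [T2Space X] [LocallyCompactSpace X] [BorelSpace X] {κ : X → X → ℝ≥0∞}

lemma potential_smul (c : ℝ≥0∞) (μ : Measure X) (x : X) :
    potential κ (c • μ) x = c * potential κ μ x := by
  rw [potential, lintegral_smul_measure, smul_eq_mul, potential]

lemma ae_wcap_le_potential (hκ : IsKernel κ) (hE : EnergyPrinciple κ) {A : Set X}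
    (hw : wcap κ A ≠ ⊤) {μ : Measure X} (hμ : FinEnergy κ μ) (hA : Concentrated μ A)
    (h : ∀ ν, memBreve κ A ν → (wcap κ A).toReal ≤ pairing κ μ ν) :
    ∀ᵐ x ∂μ, wcap κ A ≤ potential κ μ x := by
  have := hμ.regular
  have := hμ.finite
  have hm := measurable_potential hκ μ
  simp only [ae_iff, not_le]
  by_contra h0
  obtain ⟨K, hK, hKB, hlt⟩ := exists_isCompact_subset_inter hA
    (measurableSet_lt hm measurable_const) (pos_iff_ne_zero.2 h0)
  have hr : FinEnergy κ (μ.restrict K) := FinEnergy.of_restrict hE hμ.mem (measure_ne_top _ _)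
  have hν := hr.normalize (hA.restrict K) (by simpa using hlt.ne')
  set ν := ((μ.restrict K) univ)⁻¹ • μ.restrict K
  have := hν.finEnergy.regular
  have := hν.finEnergy.finite
  have htop := mutualEnergy_ne_top hE hν.1 hμ.mem
  have hle := h ν hν
  rw [pairing_comm hκ hμ hν.finEnergy, pairing, ENNReal.toReal_le_toReal hw htop] at hle
  refine absurd hle (not_le.2 ?_)
  rw [mutualEnergy_eq_lintegral_potential hκ] at htop ⊢
  have hν0 : ν ≠ 0 := fun h => by simpa [h] using hν.2.2
  have hlt' := lintegral_strict_mono hν0 (aemeasurable_const (b := wcap κ A)) htop (by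
    refine Measure.ae_smul_measure (ae_restrict_of_forall_mem hK.measurableSet ?_) _
    exact fun x hx => (hKB hx).2)
  simpa [hν.2.2] using hlt'

/-- The equilibrium measure of a compact set. -/
lemma exists_equilibrium (hκ : IsKernel κ) (hP : IsPerfect κ) (hfr : FrostmanMax κ) {K : Set X}
    (hK : IsCompact K) (hw : wcap κ K ≠ ⊤) :
    wcap κ K ≠ 0 ∧ ∃ μ, memBreve κ K μ ∧ energy κ μ = wcap κ K ∧
      (∀ x, potential κ μ x ≤ wcap κ K) ∧
      ∀ ν, memBreve κ K ν → (wcap κ K).toReal ≤ pairing κ μ ν := by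
  have hE := hP.1
  obtain ⟨m, hm, hlim⟩ := exists_tendsto_wcap hw
  obtain ⟨μ, hμ, -, hv, hen, hvar⟩ := exists_strongLimit_of_tendsto_wcap hκ hP hm hlim
  have := hμ.regular
  have := hμ.finite
  have hn : ∀ n, m n Kᶜ = 0 := fun n => by
    have := (hm n).finEnergy.regular
    have := (hm n).finEnergy.finite
    exact (hm n).2.1.measure_compl
  have hconc : Concentrated μ K :=
    concentrated_of_measure_compl (measure_compl_eq_zero_of_vague hK hn hv)
  have h1 : μ univ = 1 := measure_univ_eq_one_of_vague hK hn (fun n => (hm n).2.2) hv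
  have hen' : energy κ μ = wcap κ K :=
    (ENNReal.toReal_eq_toReal_iff' hμ.energy_lt_top.ne hw).1 hen
  have hw0 : wcap κ K ≠ 0 := fun h0 => by
    have := eq_zero_of_energy_eq_zero hE hμ.regular (hen'.trans h0)
    simp [this] at h1
  refine ⟨hw0, μ, ⟨hμ.mem, hconc, h1⟩, hen', fun x => ?_, hvar⟩
  have hae : (fun _ => wcap κ K) =ᵐ[μ] potential κ μ := by
    refine ae_eq_of_ae_le_of_lintegral_le (ae_wcap_le_potential hκ hE hw hμ hconc hvar) ?_
      (measurable_potential hκ μ).aemeasurable ?_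
    · simpa [h1] using hw
    · rw [← mutualEnergy_eq_lintegral_potential hκ]
      rw [lintegral_const, h1, mul_one]
      exact hen'.le
  have hτ := hμ.smul (ENNReal.inv_ne_top.2 hw0)
  have hfrost := hfr ((wcap κ K)⁻¹ • μ) hτ.mem (fun y hy => ?_) x
  · rwa [potential_smul, ENNReal.inv_mul_le_iff hw0 hw, mul_one] at hfrost
  · rw [potential_smul, ENNReal.inv_mul_le_iff hw0 hw, mul_one]
    by_contra! hlt
    have hpos := hy _ ((lowerSemicontinuous_potential hκ μ).isOpen_preimage (wcap κ K)) hlt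
    refine hpos.ne' ?_
    rw [Measure.smul_apply, smul_eq_mul, mul_eq_zero]
    exact Or.inr (measure_mono_null (fun z hz => (ne_of_lt hz : _)) (ae_iff.1 hae))

lemma exists_equilibrium_normalized (hκ : IsKernel κ) (hP : IsPerfect κ) (hfr : FrostmanMax κ)
    {K : Set X} (hK : IsCompact K) (hw : wcap κ K ≠ ⊤) :
    ∃ τ, FinEnergy κ τ ∧ Concentrated τ K ∧ (∀ x, potential κ τ x ≤ 1) ∧
      ∀ ν, FinEnergy κ ν → Concentrated ν K → ν univ ≤ mutualEnergy κ τ ν := by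
  obtain ⟨hw0, μ, hμ, -, hle, hvar⟩ := exists_equilibrium hκ hP hfr hK hw
  refine ⟨(wcap κ K)⁻¹ • μ, hμ.finEnergy.smul (ENNReal.inv_ne_top.2 hw0), hμ.2.1.smul _,
    fun x => ?_, fun ν hν hνK => ?_⟩
  · rw [potential_smul, ENNReal.inv_mul_le_iff hw0 hw, mul_one]
    exact hle x
  · have := hν.finite
    rcases eq_or_ne (ν univ) 0 with h0 | h0
    · simp [h0]
    have hn := hν.normalize hνK h0
    have h := hvar _ hn
    rw [pairing, ENNReal.toReal_le_toReal hw (mutualEnergy_ne_top hP.1 hμ.1 hn.1),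
      mutualEnergy_smul_right] at h
    rw [mutualEnergy_smul_left]
    rw [← ENNReal.div_eq_inv_mul, ENNReal.le_div_iff_mul_le (Or.inl h0)
      (Or.inl (measure_ne_top ν _))] at h
    rw [← ENNReal.div_eq_inv_mul, ENNReal.le_div_iff_mul_le (Or.inl hw0) (Or.inl hw), mul_comm]
    exact h

/-- Mass bound for a measure whose potential is nearly everywhere prescribed. -/
lemma measure_univ_le_of_nearlyEverywhere (hκ : IsKernel κ) (hP : IsPerfect κ)
    (hfr : FrostmanMax κ) {A : Set X} {η : Measure X} (hη : memEplus κ η)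
    (hA : Concentrated η A) {g : X → ℝ≥0∞} (hg : Measurable g)
    (hne : NearlyEverywhere κ A fun x => potential κ η x = g x) {M : ℝ≥0∞}
    (hM : ∀ τ, FinEnergy κ τ → Concentrated τ A → (∀ x, potential κ τ x ≤ 1) →
      ∫⁻ x, g x ∂τ ≤ M) : η univ ≤ M := by
  have hE := hP.1
  have : η.Regular := hη.1
  refine measure_univ_le_of_isCompact η fun C hC => le_of_forall_lt fun c hc => ?_
  have hrC : FinEnergy κ (η.restrict C) := FinEnergy.of_restrict hE hη hC.measure_lt_top.ne
  have := hrC.regular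
  have := hrC.finite
  obtain ⟨K, hK, hKC, hlt⟩ := exists_isCompact_subset_inter (hA.restrict C) hC.measurableSet
    (show c < η.restrict C C by simpa using hc)
  replace hlt : c < η K := hlt.trans_le (Measure.restrict_apply_le _ _)
  refine hlt.trans_le ?_
  have hρ : FinEnergy κ (η.restrict K) := FinEnergy.of_restrict hE hη hK.measure_lt_top.ne
  have := hρ.regular
  have := hρ.finite
  have hw : wcap κ K ≠ ⊤ := wcap_ne_top_of_measure_ne_zero hE hρ hK subset_rfl
    (by simpa using (zero_le.trans_lt hlt).ne')
  obtain ⟨τ, hτ, hτK, hτ1, hτν⟩ := exists_equilibrium_normalized hκ hP hfr hK hw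
  have hτA : Concentrated τ A := hτK.mono fun x hx => (hKC hx).1
  have := hτ.regular
  have := hτ.finite
  calc η K = η.restrict K univ := by simp
    _ ≤ mutualEnergy κ τ (η.restrict K) := hτν _ hρ (concentrated_restrict_isCompact η hK)
    _ = ∫⁻ x, potential κ (η.restrict K) x ∂τ := mutualEnergy_eq_lintegral_potential hκ _ _
    _ ≤ ∫⁻ x, g x ∂τ := by
      refine lintegral_mono_ae ?_
      simp only [ae_iff, not_le]
      refine measure_eq_zero_of_nearlyEverywhere hE hne hτ hτA
        (measurableSet_lt hg (measurable_potential hκ _)) fun x _ hx hxe => ?_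
      refine absurd (show g x < _ from hx) (not_lt.2 ?_)
      rw [← hxe]
      exact lintegral_mono' Measure.restrict_le_self le_rfl
    _ ≤ M := hM τ hτ hτA hτ1

/-- Prescribing the potential nearly everywhere determines the mutual energies. -/
lemma mutualEnergy_eq_lintegral_of_nearlyEverywhere (hκ : IsKernel κ) (hE : EnergyPrinciple κ)
    {A : Set X} {η : Measure X} (hη : FinEnergy κ η) {g : X → ℝ≥0∞} (hg : Measurable g)
    (hne : NearlyEverywhere κ A fun x => potential κ η x = g x) {ν : Measure X}
    (hν : FinEnergy κ ν) (hνA : Concentrated ν A) : mutualEnergy κ ν η = ∫⁻ x, g x ∂ν := by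
  have := hη.regular
  have := hη.finite
  have := hν.regular
  have := hν.finite
  rw [mutualEnergy_eq_lintegral_potential hκ]
  refine lintegral_congr_ae (ae_iff.2 ?_)
  exact measure_eq_zero_of_nearlyEverywhere hE hne hν hνA
    (measurableSet_eq_fun (measurable_potential hκ η) hg).compl fun x _ hx => hx

lemma balayage_measure_univ_le (hκ : IsKernel κ) (hP : IsPerfect κ) (hfr : FrostmanMax κ)
    {A : Set X} {ζ β : Measure X} (hζ : FinEnergy κ ζ) (hβ : IsInnerBalayage κ A ζ β) :
    β univ ≤ ζ univ := by
  have := hζ.regular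
  have := hζ.finite
  refine measure_univ_le_of_nearlyEverywhere hκ hP hfr hβ.1 hβ.2.1 (measurable_potential hκ ζ)
    hβ.2.2 fun τ hτ _ h1 => ?_
  have := hτ.regular
  have := hτ.finite
  rw [← mutualEnergy_eq_lintegral_potential hκ, mutualEnergy_comm hκ,
    mutualEnergy_eq_lintegral_potential hκ]
  exact (lintegral_mono h1).trans (by simp)

lemma measure_univ_le_innerCap (hκ : IsKernel κ) {A : Set X} {τ : Measure X}
    (hτ : FinEnergy κ τ) (hA : Concentrated τ A) (h1 : ∀ x, potential κ τ x ≤ 1) :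
    τ univ ≤ innerCap κ A := by
  have := hτ.regular
  have := hτ.finite
  rcases eq_or_ne (τ univ) 0 with h0 | h0
  · simp [h0]
  have htop := measure_ne_top τ univ
  rw [innerCap, ENNReal.le_inv_iff_le_inv]
  refine (iInf₂_le _ (hτ.normalize hA h0)).trans ?_
  rw [energy, mutualEnergy_smul_left, mutualEnergy_smul_right, mutualEnergy_eq_lintegral_potential hκ]
  calc _ ≤ (τ univ)⁻¹ * ((τ univ)⁻¹ * τ univ) := by
        gcongr
        exact (lintegral_mono h1).trans (by simp)
    _ = (τ univ)⁻¹ := by rw [ENNReal.inv_mul_cancel h0 htop, mul_one]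

end Equilibrium

section Capacitary

variable [T2Space X] [LocallyCompactSpace X] [BorelSpace X] {κ : X → X → ℝ≥0∞}

lemma exists_isCompact_wcap_lt (hE : EnergyPrinciple κ) {A : Set X} {c : ℝ≥0∞}
    (hc : wcap κ A < c) : ∃ K, IsCompact K ∧ K ⊆ A ∧ wcap κ K < c := by
  rw [wcap] at hc
  simp only [iInf_lt_iff] at hc
  obtain ⟨ν, hν, hlt⟩ := hc
  have hf := hν.finEnergy
  have := hf.regular
  have := hf.finite
  have hne : (𝓝[<] (1 : ℝ≥0∞)).NeBot := nhdsLT_neBot_of_exists_lt ⟨0, zero_lt_one⟩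
  have hinv : Tendsto (fun r : ℝ≥0∞ => r⁻¹) (𝓝[<] 1) (𝓝 1) :=
    ((continuous_inv.tendsto (1 : ℝ≥0∞)).mono_left nhdsWithin_le_nhds).trans (by simp)
  have hlim : Tendsto (fun r : ℝ≥0∞ => r⁻¹ * (r⁻¹ * energy κ ν)) (𝓝[<] 1) (𝓝 (energy κ ν)) := by
    have h := ENNReal.Tendsto.mul hinv (Or.inl one_ne_zero)
      (ENNReal.Tendsto.mul_const hinv (Or.inr hν.1.2.ne)) (Or.inr ENNReal.one_ne_top)
    simpa using h
  obtain ⟨r, hr, hr1⟩ := ((hlim.eventually_lt_const hlt).and self_mem_nhdsWithin).exists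
  obtain ⟨K, hK, hKA, hrK⟩ := exists_isCompact_subset_inter hν.2.1 MeasurableSet.univ
    (show r < ν univ from hν.2.2 ▸ hr1)
  have hρ : FinEnergy κ (ν.restrict K) := FinEnergy.of_restrict hE hν.1 (measure_ne_top _ _)
  have := hρ.finite
  have hn := hρ.normalize (concentrated_restrict_isCompact ν hK)
    (by simpa using (zero_le.trans_lt hrK).ne')
  refine ⟨K, hK, fun x hx => (hKA hx).1, (iInf₂_le _ hn).trans_lt (lt_of_le_of_lt ?_ hr)⟩
  rw [energy, mutualEnergy_smul_left, mutualEnergy_smul_right, Measure.restrict_apply_univ]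
  have := energy_restrict_le hE hν.1.1 (measure_ne_top ν K)
  rw [energy] at this
  gcongr

/-- A measure of finite mass and energy concentrated on `A` whose potential acts as the constant
`1` on `A`, in the weak sense of mutual energies. -/
structure IsWeakCapacitary (κ : X → X → ℝ≥0∞) (A : Set X) (γ : Measure X) : Prop where
  finEnergy : FinEnergy κ γ
  concentrated : Concentrated γ A
  pairing_eq : ∀ ν, FinEnergy κ ν → Concentrated ν A → pairing κ γ ν = (ν univ).toReal

lemma exists_isWeakCapacitary (hκ : IsKernel κ) (hP : IsPerfect κ) (hfr : FrostmanMax κ)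
    {A : Set X} (hclosed : StrongClosedEplusOn κ A) (hw : wcap κ A ≠ ⊤) (hw0 : wcap κ A ≠ 0) :
    ∃ γ, IsWeakCapacitary κ A γ := by
  have hE := hP.1
  have hstep : ∀ n : ℕ, ∃ μ, memBreve κ A μ ∧
      ∀ ν, memBreve κ A ν → pairing κ μ ν ≤ (wcap κ A).toReal + 1 / (n + 1) := by
    intro n
    have hn : (0 : ℝ) < 1 / (n + 1) := by positivity
    obtain ⟨K, hK, hKA, hlt⟩ := exists_isCompact_wcap_lt hE
      (ENNReal.lt_add_right hw (ENNReal.ofReal_pos.2 hn).ne')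
    obtain ⟨-, μ, hμ, -, hle, -⟩ := exists_equilibrium hκ hP hfr hK hlt.ne_top
    refine ⟨μ, hμ.mono hKA, fun ν hν => ?_⟩
    have := hμ.finEnergy.regular
    have := hμ.finEnergy.finite
    have := hν.finEnergy.regular
    have := hν.finEnergy.finite
    rw [pairing_comm hκ hμ.finEnergy hν.finEnergy, pairing, mutualEnergy_eq_lintegral_potential hκ,
      ← ENNReal.toReal_ofReal hn.le, ← ENNReal.toReal_add hw ENNReal.ofReal_ne_top]
    refine ENNReal.toReal_mono (ENNReal.add_ne_top.2 ⟨hw, ENNReal.ofReal_ne_top⟩) ?_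
    exact (lintegral_mono fun x => (hle x).trans hlt.le).trans (by simp [hν.2.2])
  choose μ hμ hle using hstep
  have hbound : Tendsto (fun n : ℕ => (wcap κ A).toReal + 1 / ((n : ℝ) + 1)) atTop
      (𝓝 (wcap κ A).toReal) := by
    simpa using tendsto_one_div_add_atTop_nhds_zero_nat.const_add (wcap κ A).toReal
  obtain ⟨μ₀, hμ₀, hst, -, -, hvar⟩ := exists_strongLimit_of_tendsto_wcap hκ hP hμ
    (tendsto_of_tendsto_of_tendsto_of_le_of_le tendsto_const_nhds hbound
      (fun n => (hμ n).wcap_le) fun n => hle n _ (hμ n))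
  have heq : ∀ ν, memBreve κ A ν → pairing κ μ₀ ν = (wcap κ A).toReal := fun ν hν =>
    le_antisymm (le_of_tendsto_of_tendsto' (tendsto_pairing hκ hE (fun n => (hμ n).finEnergy) hμ₀
      hν.finEnergy hst) hbound fun n => hle n ν hν) (hvar ν hν)
  have hpos := ENNReal.toReal_pos hw0 hw
  refine ⟨(wcap κ A)⁻¹ • μ₀, hμ₀.smul (ENNReal.inv_ne_top.2 hw0),
    (hclosed μ μ₀ (fun n => ⟨(hμ n).1, (hμ n).2.1⟩) hμ₀.mem hst).smul _, fun ν hν hνA => ?_⟩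
  rw [pairing_smul_left _ hν, ENNReal.toReal_inv]
  have := hν.finite
  rcases eq_or_ne (ν univ) 0 with h0 | h0
  · rw [Measure.measure_univ_eq_zero.1 h0, pairing, mutualEnergy_zero_right]
    simp
  have h := heq _ (hν.normalize hνA h0)
  have h1 := ENNReal.toReal_pos h0 (measure_ne_top ν _)
  rw [pairing_smul_right _ hν, ENNReal.toReal_inv] at h
  field_simp at h ⊢
  rw [h]

lemma IsCapacitaryMeasure.isWeakCapacitary (hκ : IsKernel κ) (hP : IsPerfect κ)
    (hfr : FrostmanMax κ) {A : Set X} {γ : Measure X} (hγ : IsCapacitaryMeasure κ A γ)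
    (hcap : innerCap κ A ≠ ⊤) : IsWeakCapacitary κ A γ := by
  have hle : γ univ ≤ innerCap κ A := measure_univ_le_of_nearlyEverywhere hκ hP hfr hγ.1 hγ.2.1
    measurable_const hγ.2.2 fun τ hτ hτA h1 => by
      simpa using measure_univ_le_innerCap hκ hτ hτA h1
  have hfin : FinEnergy κ γ := ⟨hγ.1.1, ⟨hle.trans_lt hcap.lt_top⟩, hγ.1.2⟩
  refine ⟨hfin, hγ.2.1, fun ν hν hνA => ?_⟩
  rw [pairing_comm hκ hfin hν, pairing, mutualEnergy_eq_lintegral_of_nearlyEverywhere hκ hP.1 hfin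
    measurable_const hγ.2.2 hν hνA]
  simp

lemma IsWeakCapacitary.measure_univ (hκ : IsKernel κ) (hE : EnergyPrinciple κ) {A : Set X}
    {γ : Measure X} (hγ : IsWeakCapacitary κ A γ) (hw : wcap κ A ≠ ⊤) (hw0 : wcap κ A ≠ 0) :
    γ univ = innerCap κ A := by
  have hf := hγ.finEnergy
  have := hf.finite
  have hself := hγ.pairing_eq γ hf hγ.concentrated
  have hge : 1 ≤ (γ univ).toReal * (wcap κ A).toReal := by
    obtain ⟨ν, hν, hlim⟩ := exists_tendsto_wcap hw
    refine ge_of_tendsto' (hlim.const_mul (γ univ).toReal) fun n => ?_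
    have h := pairing_sq_le hκ hE hf (hν n).finEnergy
    rw [hγ.pairing_eq _ (hν n).finEnergy (hν n).2.1, (hν n).2.2, hself] at h
    simpa using h
  have h0 : γ univ ≠ 0 := fun h0 => by simp [h0] at hge; linarith
  have hpos := ENNReal.toReal_pos h0 (measure_ne_top γ _)
  have hle := (hf.normalize hγ.concentrated h0).wcap_le
  rw [pairing_smul_left _ (hf.smul (ENNReal.inv_ne_top.2 h0)), pairing_smul_right _ hf, hself,
    ENNReal.toReal_inv, inv_mul_cancel₀ hpos.ne', mul_one] at hle
  have hle' : (γ univ).toReal * (wcap κ A).toReal ≤ 1 := by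
    calc _ ≤ (γ univ).toReal * (γ univ).toReal⁻¹ := by gcongr
      _ = 1 := mul_inv_cancel₀ hpos.ne'
  rw [innerCap, ← ENNReal.toReal_eq_toReal_iff' (measure_ne_top γ _) (ENNReal.inv_ne_top.2 hw0),
    ENNReal.toReal_inv]
  exact eq_inv_of_mul_eq_one_left (le_antisymm hle' hge)

end Capacitary

section GaussProblem

variable [T2Space X] [LocallyCompactSpace X] [BorelSpace X] {κ : X → X → ℝ≥0∞} {A : Set X}
  {f : X → EReal} {ζ β : Measure X}

lemma fieldIntegrable_neg_potential (hκ : IsKernel κ) (hE : EnergyPrinciple κ)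
    (hζ : FinEnergy κ ζ) (hf : ∀ x, f x = -((potential κ ζ x : ℝ≥0∞) : EReal)) {μ : Measure X}
    (hμ : FinEnergy κ μ) : FieldIntegrable f μ ∧ fieldIntegral f μ = -pairing κ ζ μ := by
  have := hζ.regular
  have := hζ.finite
  have := hμ.regular
  have := hμ.finite
  have hm := measurable_potential hκ ζ
  have htop := mutualEnergy_ne_top hE hμ.mem hζ.mem
  have hpair : pairing κ ζ μ = (∫⁻ x, potential κ ζ x ∂μ).toReal := by
    rw [pairing_comm hκ hζ hμ, pairing, mutualEnergy_eq_lintegral_potential hκ]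
  rw [mutualEnergy_eq_lintegral_potential hκ] at htop
  have hlt := ae_lt_top hm htop
  have hreal : (fun x => (f x).toReal) = fun x => -(potential κ ζ x).toReal := by
    funext x
    rw [hf x, EReal.toReal_neg_eq, EReal.toReal_coe_ennreal]
  refine ⟨⟨?_, hlt.mono fun x hx => ?_⟩, ?_⟩
  · rw [hreal]
    exact (integrable_toReal_of_lintegral_ne_top hm.aemeasurable htop).neg
  · rw [hf x]
    exact ⟨by simp, by simpa using hx.ne⟩
  · rw [fieldIntegral, hreal, integral_neg, integral_toReal hm.aemeasurable hlt, hpair]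

lemma isSolution_iff (hκ : IsKernel κ) (hE : EnergyPrinciple κ) (hζ : FinEnergy κ ζ)
    (hf : ∀ x, f x = -((potential κ ζ x : ℝ≥0∞) : EReal)) (hβ : FinEnergy κ β)
    (hpair : ∀ ν, FinEnergy κ ν → Concentrated ν A → pairing κ β ν = pairing κ ζ ν)
    {l : Measure X} : IsSolution κ A f l ↔
      memBreve κ A l ∧ ∀ μ, memBreve κ A μ → distSq κ l β ≤ distSq κ μ β := by
  have hg : ∀ μ, memBreve κ A μ → Admissible κ A f μ ∧
      gaussI κ f μ = distSq κ μ β - pairing κ β β := by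
    intro μ hμ
    obtain ⟨h1, h2⟩ := fieldIntegrable_neg_potential hκ hE hζ hf hμ.finEnergy
    refine ⟨⟨hμ, h1⟩, ?_⟩
    rw [gaussI, h2, ← hpair μ hμ.finEnergy hμ.2.1, distSq, pairing_comm hκ hβ hμ.finEnergy]
    simp only [pairing, energy]
    ring
  refine ⟨fun h => ⟨h.1.1, fun μ hμ => ?_⟩, fun ⟨hl, hmin⟩ => ⟨(hg l hl).1, ?_⟩⟩
  · have hle : ((gaussI κ f l : ℝ) : EReal) ≤ (gaussI κ f μ : ℝ) :=
      h.2.le.trans (iInf₂_le μ (hg μ hμ).1)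
    rw [EReal.coe_le_coe_iff, (hg l h.1.1).2, (hg μ hμ).2] at hle
    linarith
  · refine le_antisymm (le_iInf₂ fun μ hμ => ?_) (iInf₂_le l (hg l hl).1)
    rw [EReal.coe_le_coe_iff, (hg l hl).2, (hg μ hμ.1).2]
    linarith [hmin μ hμ.1]

/-- The candidate solution when the capacity is finite, with the Pythagorean identity showing that
it is the nearest point to `β`. -/
lemma memBreve_add_smul_and_distSq (hκ : IsKernel κ) (hE : EnergyPrinciple κ)
    (hβ : FinEnergy κ β) (hβA : Concentrated β A) (hβ1 : β univ ≤ 1) {γ : Measure X}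
    (hγ : IsWeakCapacitary κ A γ) (hcap : innerCap κ A ≠ ⊤) (hcap0 : innerCap κ A ≠ 0) :
    memBreve κ A (β + ((1 - β univ) / innerCap κ A) • γ) ∧
      ∀ μ, memBreve κ A μ →
        distSq κ μ β = distSq κ (β + ((1 - β univ) / innerCap κ A) • γ) β
          + distSq κ μ (β + ((1 - β univ) / innerCap κ A) • γ) := by
  set c := (1 - β univ) / innerCap κ A
  have hc : c ≠ ⊤ := ENNReal.div_ne_top (ENNReal.sub_ne_top ENNReal.one_ne_top) hcap0
  have hf := hγ.finEnergy
  have hcγ := hf.smul hc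
  have hl := hβ.add hκ hE hcγ
  have hmass : β univ + c * γ univ = 1 := by
    rw [hγ.measure_univ hκ hE (fun h => hcap0 (by simp [innerCap, h]))
      (fun h => hcap (by simp [innerCap, h])), ENNReal.div_mul_cancel hcap0 hcap]
    exact add_tsub_cancel_of_le hβ1
  have hb : memBreve κ A (β + c • γ) := ⟨hl.mem, hβA.add (hγ.concentrated.smul c), by simpa⟩
  refine ⟨hb, fun μ hμ => ?_⟩
  have hμ' := hμ.finEnergy
  have h1 := hγ.pairing_eq μ hμ' hμ.2.1
  have h2 := hγ.pairing_eq _ hl hb.2.1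
  rw [hμ.2.2, ENNReal.toReal_one, pairing_comm hκ hf hμ'] at h1
  rw [hb.2.2, ENNReal.toReal_one, pairing_add_right hκ hE hβ hcγ hf, pairing_smul_right _ hf] at h2
  simp only [distSq, pairing_add_left hE hβ hcγ hl, pairing_add_left hE hβ hcγ hβ,
    pairing_smul_left c hl, pairing_smul_left c hβ, pairing_add_right hκ hE hβ hcγ hβ,
    pairing_add_right hκ hE hβ hcγ hμ', pairing_add_right hκ hE hβ hcγ hf,
    pairing_smul_right c hf, h1, pairing_comm hκ hβ hf]
  linear_combination (-2 * c.toReal) * h2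

lemma eq_of_wcap_eq_zero (hκ : IsKernel κ) (hE : EnergyPrinciple κ)
    (hβ : FinEnergy κ β) (hβA : Concentrated β A) (hβ1 : β univ ≤ 1) (hw : wcap κ A = 0)
    {l : Measure X} (hl : memBreve κ A l)
    (hmin : ∀ μ, memBreve κ A μ → distSq κ l β ≤ distSq κ μ β) : l = β := by
  obtain ⟨ν, hν, hlim⟩ := exists_tendsto_wcap (κ := κ) (B := A) (by simp [hw])
  set c := 1 - β univ
  have hc : c ≠ ⊤ := ENNReal.sub_ne_top ENNReal.one_ne_top
  refine eq_of_distSq_le_zero hE hl.finEnergy hβ ?_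
  have hlim' := hlim.const_mul (c.toReal ^ 2)
  rw [hw, ENNReal.toReal_zero, mul_zero] at hlim'
  refine ge_of_tendsto' hlim' fun n => ?_
  have hn := (hν n).finEnergy
  have hcν := hn.smul hc
  have hs := hβ.add hκ hE hcν
  have hb : memBreve κ A (β + c • ν n) := ⟨hs.mem, hβA.add ((hν n).2.1.smul c), by
    simpa [(hν n).2.2] using add_tsub_cancel_of_le hβ1⟩
  refine (hmin _ hb).trans (le_of_eq ?_)
  simp only [distSq, pairing_add_left hE hβ hcν hs, pairing_add_left hE hβ hcν hβ,
    pairing_smul_left c hs, pairing_smul_left c hβ, pairing_add_right hκ hE hβ hcν hβ,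
    pairing_add_right hκ hE hβ hcν hn, pairing_smul_right c hn, pairing_comm hκ hβ hn]
  ring

end GaussProblem

theorem stmt4 {X : Type*} [TopologicalSpace X] [T2Space X] [LocallyCompactSpace X]
    [MeasurableSpace X] [BorelSpace X]
    (κ : X → X → ℝ≥0∞) (A : Set X) (ζ β : Measure X) (f : X → EReal)
    (hker : IsKernel κ) (hperf : IsPerfect κ)
    (hfr : FrostmanMax κ) (hdom : DominationPrinciple κ)
    (hcap0 : innerCap κ A ≠ 0) (hclosed : StrongClosedEplusOn κ A)
    (hζ : memEplus κ ζ) (hζ1 : ζ Set.univ ≤ 1)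
    (hf : ∀ x, f x = -((potential κ ζ x : ℝ≥0∞) : EReal))
    (hβ : IsInnerBalayage κ A ζ β) :
    ((∃ l : Measure X, IsSolution κ A f l) ↔
      (innerCap κ A ≠ ⊤ ∨ β Set.univ = 1)) ∧
    (innerCap κ A ≠ ⊤ →
      ∀ γ : Measure X, IsCapacitaryMeasure κ A γ →
        ∀ l : Measure X, IsSolution κ A f l →
          l = β + (((1 : ℝ≥0∞) - β Set.univ) / innerCap κ A) • γ) ∧
    (innerCap κ A = ⊤ →
      ∀ l : Measure X, IsSolution κ A f l → l = β) := by
  have hE := hperf.1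
  have hζf : FinEnergy κ ζ := ⟨hζ.1, ⟨hζ1.trans_lt ENNReal.one_lt_top⟩, hζ.2⟩
  have := hζf.regular
  have := hζf.finite
  have hβ1 : β univ ≤ 1 := (balayage_measure_univ_le hker hperf hfr hζf hβ).trans hζ1
  have hβf : FinEnergy κ β := ⟨hβ.1.1, ⟨hβ1.trans_lt ENNReal.one_lt_top⟩, hβ.1.2⟩
  have hpair : ∀ ν, FinEnergy κ ν → Concentrated ν A → pairing κ β ν = pairing κ ζ ν := by
    intro ν hν hνA
    have := hν.regular
    have := hν.finite
    rw [pairing_comm hker hβf hν, pairing_comm hker hζf hν, pairing,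
      mutualEnergy_eq_lintegral_of_nearlyEverywhere hker hE hβf (measurable_potential hker ζ)
        hβ.2.2 hν hνA, pairing, mutualEnergy_eq_lintegral_potential hker]
  have hsol := fun l => isSolution_iff (l := l) hker hE hζf hf hβf hpair
  have htop : innerCap κ A = ⊤ → ∀ l, IsSolution κ A f l → l = β := fun hcap l hl =>
    eq_of_wcap_eq_zero hker hE hβf hβ.2.1 hβ1 (ENNReal.inv_eq_top.1 hcap) ((hsol l).1 hl).1
      ((hsol l).1 hl).2
  refine ⟨⟨fun ⟨l, hl⟩ => ?_, fun h => ?_⟩, fun hcap γ hγ l hl => ?_, htop⟩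
  · refine or_iff_not_imp_left.2 fun hcap => ?_
    rw [← htop (not_not.1 hcap) l hl]
    exact hl.1.1.2.2
  · by_cases hcap : innerCap κ A = ⊤
    · refine ⟨β, (hsol β).2 ⟨⟨hβ.1, hβ.2.1, h.resolve_left (not_not.2 hcap)⟩, fun μ hμ => ?_⟩⟩
      refine le_trans (le_of_eq ?_) (distSq_nonneg hE hμ.finEnergy hβf)
      rw [distSq]
      ring
    · obtain ⟨γ, hγ⟩ := exists_isWeakCapacitary hker hperf hfr hclosed
        (fun h => hcap0 (by simp [innerCap, h])) (fun h => hcap (by simp [innerCap, h]))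
      obtain ⟨hb, hdist⟩ := memBreve_add_smul_and_distSq hker hE hβf hβ.2.1 hβ1 hγ hcap hcap0
      refine ⟨_, (hsol _).2 ⟨hb, fun μ hμ => ?_⟩⟩
      rw [hdist μ hμ]
      linarith [distSq_nonneg hE hμ.finEnergy hb.finEnergy]
  · obtain ⟨hb, hdist⟩ := memBreve_add_smul_and_distSq hker hE hβf hβ.2.1 hβ1
      (hγ.isWeakCapacitary hker hperf hfr hcap) hcap hcap0
    obtain ⟨hlb, hmin⟩ := (hsol l).1 hl
    refine eq_of_distSq_le_zero hE hlb.finEnergy hb.finEnergy ?_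
    linarith [hdist l hlb, hmin _ hb]

end GaussVar
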